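/- arXiv:1707.03231 — 2 statements merged into one kernel-verified Lean document; each statement's English description precedes it below -/
import Mathlib

section
/- Let α be a rational number, let H be a height associated to −K_X + αF, and set A = n+1+α−(a₀+a₁+a₂+e). There exists a constant C > 0 (depending on k, 𝒞, the f_{i,j}, and H) such that for every 𝐲 ∈ O_k^{n+1} with Δ(𝐲) ≠ 0 and y₀O_k + … + y_nO_k ∈ 𝒞, and every B > 0, the number N(C_𝐲, H_𝐲, B) of points x ∈ ℙ²(k) with Q_𝐲(x) = 0 and H_𝐲(x) ≤ B satisfies N(C_𝐲, H_𝐲, B) ≤ C · τ_k(Δ(𝐲)O_k) · ( B · 𝔑(Δ₀(𝐲))^{1/2} / ( H_∞(𝐲)^{(a₀+a₁+a₂)/3 + A} · |N_{k/ℚ}(Δ(𝐲))|^{1/3} ) + 1 ). -/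
/-!
Setup (Frei–Loughran, "Rational points and non-anticanonical height functions",
§2–§3): `k` a number field, `X ⊂ F_n(a₀,a₁,a₂)` a smooth hypersurface of
bidegree `(e,2)` cut out by `Q(y,x) = ∑ f_{i,j}(y) xᵢ xⱼ`, with projection
`π : X → ℙⁿ`, discriminant `Δ(y) = det (f_{i,j}(y))`, and standard height `H*`
associated to the `ℚ`-divisor `-K_X + αF`.
-/

noncomputable section

open MvPolynomial NumberField Filter Topology IsDedekindDomain

namespace Stmt

variable (k : Type) [Field k] [NumberField k] (n : ℕ)

/-- A representative `(y, x)` of a `k`-rational point of the hypersurface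
`X : ∑_{i,j} f_{i,j}(y) xᵢxⱼ = 0` inside the bundle `F_n(a₀,a₁,a₂)`. -/
structure PtRep (f : Fin 3 → Fin 3 → MvPolynomial (Fin (n + 1)) (𝓞 k)) : Type where
  y : Fin (n + 1) → k
  x : Fin 3 → k
  hy : y ≠ 0
  hx : x ≠ 0
  hQ : ∑ i : Fin 3, ∑ j : Fin 3, (aeval y (f i j)) * x i * x j = 0

variable {k n}

/-- Two representatives give the same point of `F_n(a₀,a₁,a₂)(k)` iff they differ
by the action of `𝔾ₘ²`: `(λ,μ)·(y;x) = (λy; λ^{-a₀}μx₀, λ^{-a₁}μx₁, λ^{-a₂}μx₂)`. -/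
def ptRel (a : Fin 3 → ℤ) (f : Fin 3 → Fin 3 → MvPolynomial (Fin (n + 1)) (𝓞 k))
    (P P' : PtRep k n f) : Prop :=
  ∃ l m : kˣ, (∀ i, P'.y i = (l : k) * P.y i) ∧
    ∀ j, P'.x j = ((l ^ (-(a j)) * m : kˣ) : k) * P.x j

/-- The counting function `N(U, H, B)`: the number of points of `X(k)` lying in `U`
and of height at most `B`.  (Points of `X(k)` are classes of representatives.) -/
def Ncount (a : Fin 3 → ℤ) (f : Fin 3 → Fin 3 → MvPolynomial (Fin (n + 1)) (𝓞 k))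
    (U : Set (PtRep k n f)) (H : PtRep k n f → ℝ) (B : ℝ) : ℕ :=
  Nat.card {q : Quot (ptRel a f) // ∃ P, P ∈ U ∧ H P ≤ B ∧ Quot.mk (ptRel a f) P = q}

/-- `max_i |z i|_w` at an infinite place `w`. -/
def maxAt {ι : Type} [Fintype ι] [Nonempty ι] (w : InfinitePlace k) (z : ι → k) : ℝ :=
  Finset.univ.sup' Finset.univ_nonempty fun i => w (z i)

/-- The normalized absolute value `|z|_v^{m_v} = 𝔑(𝔭_v)^{-ord_v(z)}` attached to a
finite place (height-one prime) `v` of `k`. -/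
def fnorm (v : HeightOneSpectrum (𝓞 k)) (z : k) : ℝ :=
  if h : v.valuation k z = 0 then 0
  else (Ideal.absNorm v.asIdeal : ℝ) ^ (Multiplicative.toAdd (WithZero.unzero h))

/-- `max_i |z i|_v^{m_v}` at a finite place `v`. -/
def maxAtFin {ι : Type} [Fintype ι] [Nonempty ι] (v : HeightOneSpectrum (𝓞 k)) (z : ι → k) : ℝ :=
  Finset.univ.sup' Finset.univ_nonempty fun i => fnorm v (z i)

/-- The exponent `A = n + 1 + α - (a₀ + a₁ + a₂ + e)`. -/
def Aexp (n : ℕ) (a : Fin 3 → ℤ) (e : ℤ) (α : ℚ) : ℝ :=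
  (n : ℝ) + 1 + (α : ℝ) - (((a 0 : ℤ) : ℝ) + ((a 1 : ℤ) : ℝ) + ((a 2 : ℤ) : ℝ) + (e : ℝ))

/-- The standard height `H*(y;x) = ∏_v (max_i |y_i|_v^A · max_j (max_i |y_i|_v^{a_j} |x_j|_v))^{m_v}`
associated to the `ℚ`-divisor `-K_X + αF = M + AF`. -/
def Hstd (a : Fin 3 → ℤ) (e : ℤ) (α : ℚ)
    (f : Fin 3 → Fin 3 → MvPolynomial (Fin (n + 1)) (𝓞 k)) (P : PtRep k n f) : ℝ :=
  (∏ w : InfinitePlace k,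
      (maxAt w P.y ^ Aexp n a e α *
        Finset.univ.sup' Finset.univ_nonempty
          (fun j => maxAt w P.y ^ ((a j : ℤ) : ℝ) * w (P.x j))) ^ w.mult) *
  ∏ᶠ v : HeightOneSpectrum (𝓞 k),
      (maxAtFin v P.y ^ Aexp n a e α *
        Finset.univ.sup' Finset.univ_nonempty
          (fun j => maxAtFin v P.y ^ ((a j : ℤ) : ℝ) * fnorm v (P.x j)))

/-- The defining polynomial `Q = ∑_{i,j} f_{i,j}(y) xᵢxⱼ`, as a polynomial over `k`
  in the variables `y₀, …, y_n, x₀, x₁, x₂`. -/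
def Qk (f : Fin 3 → Fin 3 → MvPolynomial (Fin (n + 1)) (𝓞 k)) :
    MvPolynomial (Fin (n + 1) ⊕ Fin 3) k :=
  ∑ i : Fin 3, ∑ j : Fin 3,
    rename Sum.inl (map (algebraMap (𝓞 k) k) (f i j)) * X (Sum.inr i) * X (Sum.inr j)

/-- Smoothness of the hypersurface `X : Q = 0`: at every point over an algebraic
closure of `k` (with `y ≠ 0`, `x ≠ 0`) where `Q` vanishes, some partial derivative
of `Q` is nonzero. -/
def IsSmoothX (f : Fin 3 → Fin 3 → MvPolynomial (Fin (n + 1)) (𝓞 k)) : Prop :=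
  ∀ y : Fin (n + 1) → AlgebraicClosure k, ∀ x : Fin 3 → AlgebraicClosure k,
    y ≠ 0 → x ≠ 0 → aeval (Sum.elim y x) (Qk f) = 0 →
      ∃ s, aeval (Sum.elim y x) (pderiv s (Qk f)) ≠ 0

/-- The coefficients `f_{i,j}` are symmetric and homogeneous of degree `aᵢ + aⱼ + e`,
so that `Q` is bihomogeneous of bidegree `(e,2)` on `F_n(a₀,a₁,a₂)`. -/
def DegOK (a : Fin 3 → ℤ) (e : ℤ) (f : Fin 3 → Fin 3 → MvPolynomial (Fin (n + 1)) (𝓞 k)) : Prop :=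
  ∀ i j, f i j = f j i ∧ (f i j).IsHomogeneous (a i + a j + e).toNat ∧
    (a i + a j + e < 0 → f i j = 0)

/-- The discriminant `Δ(y) = det (f_{i,j}(y))`, evaluated at `y ∈ kⁿ⁺¹`. -/
def Deltak (f : Fin 3 → Fin 3 → MvPolynomial (Fin (n + 1)) (𝓞 k))
    (y : Fin (n + 1) → k) : k :=
  Matrix.det (Matrix.of fun i j => aeval y (f i j))

/-- A polynomial in the Cox ring of `F_n(a₀,a₁,a₂)` is bihomogeneous (of some bidegree
`(d₁,d₂)`) with respect to the `𝔾ₘ²`-action; the nonvanishing loci of such polynomials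
define the open subsets of `F_n(a₀,a₁,a₂)`. -/
def IsBihom (a : Fin 3 → ℤ) (g : MvPolynomial (Fin (n + 1) ⊕ Fin 3) k) : Prop :=
  ∃ (d₁ : ℤ) (d₂ : ℕ), ∀ (l m : kˣ) (y : Fin (n + 1) → k) (x : Fin 3 → k),
    eval (Sum.elim (fun i => (l : k) * y i) fun j => ((l ^ (-(a j)) * m : kˣ) : k) * x j) g =
      (l : k) ^ d₁ * (m : k) ^ d₂ * eval (Sum.elim y x) g

/-- The value `Δ(𝐲) = det (f_{i,j}(𝐲)) ∈ O_k` at an integral point `𝐲 ∈ O_kⁿ⁺¹`. -/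
def DeltaO (f : Fin 3 → Fin 3 → MvPolynomial (Fin (n + 1)) (𝓞 k))
    (z : Fin (n + 1) → 𝓞 k) : 𝓞 k :=
  Matrix.det (Matrix.of fun i j => eval z (f i j))

/-- The ideal `Δ₀(𝐲) ⊆ O_k` generated by the `2×2` minors of the matrix `(f_{i,j}(𝐲))`. -/
def minorsIdeal (f : Fin 3 → Fin 3 → MvPolynomial (Fin (n + 1)) (𝓞 k))
    (z : Fin (n + 1) → 𝓞 k) : Ideal (𝓞 k) :=
  Ideal.span {d | ∃ i₀ i₁ j₀ j₁ : Fin 3, i₀ ≠ i₁ ∧ j₀ ≠ j₁ ∧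
    d = eval z (f i₀ j₀) * eval z (f i₁ j₁) - eval z (f i₀ j₁) * eval z (f i₁ j₀)}

/-- The divisor function `τ_k` on nonzero ideals of `O_k`, evaluated at the
principal ideal `(r)`. -/
def tauk {k : Type} [Field k] [NumberField k] (r : 𝓞 k) : ℕ :=
  Nat.card {J : Ideal (𝓞 k) // J ∣ Ideal.span {r}}

/-- The archimedean height `H_∞(𝐲) = ∏_{v ∣ ∞} max_i |y_i|_v^{m_v}`. -/
def Hinf (z : Fin (n + 1) → 𝓞 k) : ℝ :=
  ∏ w : InfinitePlace k, maxAt w (fun i => algebraMap (𝓞 k) k (z i)) ^ w.mult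

/-- The number `N(C_𝐲, H_𝐲, B)` of points `x ∈ ℙ²(k)` on the conic
`C_𝐲 : Q_𝐲(x) = 0` with `H_𝐲(x) = H(𝐲; x) ≤ B`; equivalently, the number of
points of the fibre `X_𝐲` of height at most `B` (via `C_𝐲 ≅ X_𝐲`). -/
def NcountFib (a : Fin 3 → ℤ) (f : Fin 3 → Fin 3 → MvPolynomial (Fin (n + 1)) (𝓞 k))
    (z : Fin (n + 1) → 𝓞 k) (H : PtRep k n f → ℝ) (B : ℝ) : ℕ :=
  Nat.card {q : Quot (ptRel a f) // ∃ P : PtRep k n f,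
    (∀ i, P.y i = algebraMap (𝓞 k) k (z i)) ∧ H P ≤ B ∧ Quot.mk (ptRel a f) P = q}

set_option linter.unusedSectionVars false

section Algebra

variable {R : Type*} [CommRing R]

/-- The bilinear form attached to a `3 × 3` matrix. -/
def bil (M : Matrix (Fin 3) (Fin 3) R) (x y : Fin 3 → R) : R :=
  ∑ i, ∑ j, M i j * x i * y j

/-- The determinant of three vectors. -/
def det3 (x y z : Fin 3 → R) : R := Matrix.det (Matrix.of ![x, y, z])

lemma bil_comm {M : Matrix (Fin 3) (Fin 3) R} (hM : ∀ i j, M i j = M j i) (x y : Fin 3 → R) :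
    bil M x y = bil M y x := by
  simp only [bil, Fin.sum_univ_three, hM 1 0, hM 2 0, hM 2 1]
  ring

/-- The Gram matrix of a family of vectors is `X M Xᵀ`. -/
lemma gram_eq {ι : Type*} (M : Matrix (Fin 3) (Fin 3) R) (x : ι → Fin 3 → R) :
    Matrix.of (fun i j => bil M (x i) (x j)) =
      Matrix.of x * M * (Matrix.of x).transpose := by
  ext i j
  simp only [bil, Matrix.mul_apply, Fin.sum_univ_three, Matrix.of_apply, Matrix.transpose_apply]
  ring

lemma det3_sq_mul_det {M : Matrix (Fin 3) (Fin 3) R} (hM : ∀ i j, M i j = M j i)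
    {x y z : Fin 3 → R} :
    det3 x y z ^ 2 * M.det =
      bil M x x * bil M y y * bil M z z + 2 * bil M x y * bil M y z * bil M x z
        - bil M x x * bil M y z ^ 2 - bil M y y * bil M x z ^ 2 - bil M z z * bil M x y ^ 2 := by
  have h := congrArg Matrix.det (gram_eq M ![x, y, z])
  rw [Matrix.det_mul, Matrix.det_mul, Matrix.det_transpose, Matrix.det_fin_three] at h
  simp only [Matrix.of_apply, Matrix.cons_val_zero, Matrix.cons_val_one, Matrix.cons_val] at h
  rw [bil_comm hM y x, bil_comm hM z x, bil_comm hM z y] at h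
  have h' : Matrix.det (Matrix.of ![x, y, z]) = det3 x y z := rfl
  rw [h'] at h
  linear_combination -h

lemma det3_sq_mul_det_of_null {M : Matrix (Fin 3) (Fin 3) R} (hM : ∀ i j, M i j = M j i)
    {x y z : Fin 3 → R} (hx : bil M x x = 0) (hy : bil M y y = 0) (hz : bil M z z = 0) :
    det3 x y z ^ 2 * M.det = 2 * bil M x y * bil M y z * bil M x z := by
  rw [det3_sq_mul_det hM, hx, hy, hz]
  ring

/-- Ptolemy's relation between four isotropic vectors. -/
lemma ptolemy {M : Matrix (Fin 3) (Fin 3) R} (hM : ∀ i j, M i j = M j i)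
    {x y z w : Fin 3 → R} (hx : bil M x x = 0) (hy : bil M y y = 0) (hz : bil M z z = 0)
    (hw : bil M w w = 0) :
    (bil M x y * bil M z w - bil M x z * bil M y w - bil M x w * bil M y z) ^ 2 =
      4 * (bil M x z * bil M y w) * (bil M x w * bil M y z) := by
  have h : (Matrix.of (fun i j : Fin 4 =>
      bil M ((![x, y, z, w] : Fin 4 → Fin 3 → R) i) ((![x, y, z, w] : Fin 4 → Fin 3 → R) j))).det
        = 0 := by
    set X : Matrix (Fin 4) (Fin 4) R :=
      Matrix.of fun i j => if h : j.1 < 3 then (![x, y, z, w] : Fin 4 → Fin 3 → R) i ⟨j.1, h⟩ else 0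
    set N : Matrix (Fin 4) (Fin 4) R :=
      Matrix.of fun i j => if h : i.1 < 3 ∧ j.1 < 3 then M ⟨i.1, h.1⟩ ⟨j.1, h.2⟩ else 0
    have hX : X.det = 0 := Matrix.det_eq_zero_of_column_eq_zero (3 : Fin 4) (by simp [X])
    have hG : Matrix.of (fun i j : Fin 4 =>
        bil M ((![x, y, z, w] : Fin 4 → Fin 3 → R) i)
          ((![x, y, z, w] : Fin 4 → Fin 3 → R) j)) = X * N * X.transpose := by
      ext i j
      simp [bil, Matrix.mul_apply, Fin.sum_univ_succ, X, N]
      ring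
    rw [hG, Matrix.det_mul, Matrix.det_mul, hX]
    simp
  rw [Matrix.det_succ_row_zero] at h
  simp [Fin.sum_univ_succ, Matrix.det_fin_three, Matrix.submatrix_apply, Fin.succAbove, hx, hy, hz,
    hw] at h
  rw [bil_comm hM y x, bil_comm hM z x, bil_comm hM z y, bil_comm hM w x, bil_comm hM w y,
    bil_comm hM w z] at h
  linear_combination h

/-- The change of coordinates adapted to two isotropic vectors `P`, `Q`. -/
lemma det3_mul_bil_sq {M : Matrix (Fin 3) (Fin 3) R} (hM : ∀ i j, M i j = M j i)
    {P Q : Fin 3 → R} (hP : bil M P P = 0) (x y z : Fin 3 → R) :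
    det3 x y z * bil M P Q ^ 2 = det3
      ![bil M x Q, bil M x P, det3 P Q x] ![bil M y Q, bil M y P, det3 P Q y]
      ![bil M z Q, bil M z P, det3 P Q z] := by
  set Y : Matrix (Fin 3) (Fin 3) R := Matrix.of fun i =>
    ![∑ j, M i j * Q j, ∑ j, M i j * P j, ![P 1 * Q 2 - P 2 * Q 1, P 2 * Q 0 - P 0 * Q 2,
      P 0 * Q 1 - P 1 * Q 0] i]
  have hY : Y.det = bil M P Q ^ 2 := by
    have h1 : Y.det = bil M P Q * bil M Q P - bil M P P * bil M Q Q := by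
      simp only [Y, Matrix.det_fin_three, bil, Fin.sum_univ_three, Matrix.of_apply,
        Matrix.cons_val_zero, Matrix.cons_val_one, Matrix.cons_val]
      ring
    rw [h1, hP, bil_comm hM Q P]
    ring
  have h : Matrix.of ![![bil M x Q, bil M x P, det3 P Q x], ![bil M y Q, bil M y P, det3 P Q y],
      ![bil M z Q, bil M z P, det3 P Q z]] = Matrix.of ![x, y, z] * Y := by
    have key : ∀ u : Fin 3 → R, ∀ j : Fin 3,
        (![bil M u Q, bil M u P, det3 P Q u] : Fin 3 → R) j = ∑ l, u l * Y l j := by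
      intro u j
      fin_cases j <;>
        simp [Y, bil, det3, Matrix.det_fin_three (Matrix.of _), Fin.sum_univ_three] <;> ring
    ext i j
    rw [Matrix.mul_apply]
    fin_cases i <;> exact key _ j
  rw [show det3 ![bil M x Q, bil M x P, det3 P Q x] ![bil M y Q, bil M y P, det3 P Q y]
      ![bil M z Q, bil M z P, det3 P Q z] = _ from congrArg Matrix.det h, Matrix.det_mul, hY]
  rfl

lemma det3_sq_mul_adjugate {M : Matrix (Fin 3) (Fin 3) R} (x y z : Fin 3 → R) :
    det3 x y z ^ 2 • M.adjugate = (Matrix.of ![x, y, z]).transpose *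
      (Matrix.of (fun i j => bil M ((![x, y, z] : Fin 3 → Fin 3 → R) i)
        ((![x, y, z] : Fin 3 → Fin 3 → R) j))).adjugate * Matrix.of ![x, y, z] := by
  set X := Matrix.of ![x, y, z]
  have hd : X.det = det3 x y z := rfl
  rw [gram_eq, Matrix.adjugate_mul_distrib, Matrix.adjugate_mul_distrib]
  calc det3 x y z ^ 2 • M.adjugate
      = (X.det • (1 : Matrix (Fin 3) (Fin 3) R)) * M.adjugate * (X.det • 1) := by
        rw [hd]; simp [smul_smul, pow_two]
    _ = (X.transpose * X.transpose.adjugate) * M.adjugate * (X.adjugate * X) := by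
        rw [Matrix.mul_adjugate, Matrix.adjugate_mul, Matrix.det_transpose]
    _ = _ := by simp only [Matrix.mul_assoc]; rfl

lemma det3_sq_mul_adjugate_of_null {M : Matrix (Fin 3) (Fin 3) R} (hM : ∀ i j, M i j = M j i)
    {x y z : Fin 3 → R} (hx : bil M x x = 0) (hy : bil M y y = 0) (hz : bil M z z = 0)
    (i j : Fin 3) :
    det3 x y z ^ 2 * M.adjugate i j =
      -(bil M y z ^ 2 * (x i * x j)) - bil M x z ^ 2 * (y i * y j) - bil M x y ^ 2 * (z i * z j)
      + bil M y z * bil M x z * (x i * y j + y i * x j)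
      + bil M y z * bil M x y * (x i * z j + z i * x j)
      + bil M x z * bil M x y * (y i * z j + z i * y j) := by
  have h := congrFun (congrFun (det3_sq_mul_adjugate (M := M) x y z) i) j
  rw [Matrix.smul_apply, smul_eq_mul] at h
  rw [h]
  simp [Matrix.mul_apply, Matrix.adjugate_fin_three, Fin.sum_univ_three, hx, hy, hz,
    bil_comm hM y x, bil_comm hM z x, bil_comm hM z y]
  ring

lemma minor_eq_adjugate (M : Matrix (Fin 3) (Fin 3) R) {i₀ i₁ j₀ j₁ : Fin 3} (hi : i₀ ≠ i₁)
    (hj : j₀ ≠ j₁) : ∃ i j, M i₀ j₀ * M i₁ j₁ - M i₀ j₁ * M i₁ j₀ = M.adjugate i j ∨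
      M i₀ j₀ * M i₁ j₁ - M i₀ j₁ * M i₁ j₀ = -M.adjugate i j := by
  have key : ∀ i₀ i₁ : Fin 3, i₀ ≠ i₁ → ∃ i : Fin 3, (i₀ = i + 1 ∧ i₁ = i + 2) ∨
      (i₁ = i + 1 ∧ i₀ = i + 2) := by decide
  have key2 : ∀ i j : Fin 3, M.adjugate j i =
      M (i + 1) (j + 1) * M (i + 2) (j + 2) - M (i + 1) (j + 2) * M (i + 2) (j + 1) := by
    intro i j
    fin_cases i <;> fin_cases j <;> simp [Matrix.adjugate_fin_three] <;> ring
  obtain ⟨i, hi⟩ := key _ _ hi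
  obtain ⟨j, hj⟩ := key _ _ hj
  refine ⟨j, i, ?_⟩
  rw [key2]
  rcases hi with ⟨rfl, rfl⟩ | ⟨rfl, rfl⟩ <;> rcases hj with ⟨rfl, rfl⟩ | ⟨rfl, rfl⟩
  · left; ring
  · right; ring
  · right; ring
  · left; ring

lemma proportional_of_bil_eq_zero [IsDomain R] {M : Matrix (Fin 3) (Fin 3) R}
    (hM : ∀ i j, M i j = M j i) (hdet : M.det ≠ 0) {x y : Fin 3 → R}
    (hx : bil M x x = 0) (hy : bil M y y = 0) (hxy : bil M x y = 0) (i j : Fin 3) :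
    x i * y j = x j * y i := by
  have h : ∀ w, det3 x y w = 0 := by
    intro w
    have := det3_sq_mul_det hM (x := x) (y := y) (z := w)
    rw [hx, hy, hxy] at this
    have h2 : det3 x y w ^ 2 * M.det = 0 := by rw [this]; ring
    simpa [hdet] using h2
  have h0 := h ![1, 0, 0]
  have h1 := h ![0, 1, 0]
  have h2 := h ![0, 0, 1]
  simp [det3, Matrix.det_fin_three] at h0 h1 h2
  fin_cases i <;> fin_cases j <;> simp only [Fin.zero_eta, Fin.mk_one, Fin.reduceFinMk] <;>
  first | ring1 | linear_combination h0 | linear_combination h1 | linear_combination h2 |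
    linear_combination -h0 | linear_combination -h1 | linear_combination -h2

end Algebra

section Ultrametric

variable {R : Type*} [CommRing R]

lemma ultrametric_sum_le {v : AbsoluteValue R ℝ} (hv : IsNonarchimedean v) {a b : R} {t : ℝ}
    (ha : v a ≤ t) (hb : v b ≤ t) : v (a + b) ≤ t :=
  (hv a b).trans (max_le ha hb)

lemma ultrametric_sub_le {v : AbsoluteValue R ℝ} (hv : IsNonarchimedean v) {a b : R} {t : ℝ}
    (ha : v a ≤ t) (hb : v b ≤ t) : v (a - b) ≤ t := by
  rw [sub_eq_add_neg]
  exact ultrametric_sum_le hv ha (by rwa [v.map_neg])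

lemma ultrametric_two_le {v : AbsoluteValue R ℝ} [Nontrivial R] (hv : IsNonarchimedean v) : v 2 ≤ 1 := by
  rw [← one_add_one_eq_two]
  exact ultrametric_sum_le hv v.map_one.le v.map_one.le

lemma ultrametric_ptolemy [Nontrivial R] {v : AbsoluteValue R ℝ} (hv : IsNonarchimedean v) {a b c : R}
    (h : (a - b - c) ^ 2 = 4 * b * c) : v a ≤ max (v b) (v c) := by
  by_contra! hlt
  set m := max (v b) (v c)
  have hm : 0 ≤ m := (v.nonneg b).trans (le_max_left _ _)
  have hb : v b ≤ m := le_max_left _ _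
  have hc : v c ≤ m := le_max_right _ _
  have h2 := ultrametric_two_le hv
  have e : a ^ 2 = 2 * a * (b + c) - (b - c) ^ 2 := by linear_combination h
  have hle : v (a ^ 2) ≤ v a * m := by
    rw [e]
    refine ultrametric_sub_le hv ?_ ?_
    · rw [v.map_mul, v.map_mul]
      have := ultrametric_sum_le hv hb hc
      have ha := v.nonneg a
      calc v 2 * v a * v (b + c) ≤ 1 * v a * m := by gcongr
        _ = _ := by ring
    · rw [v.map_pow, pow_two]
      have := ultrametric_sub_le hv hb hc
      have := v.nonneg (b - c)
      gcongr
      linarith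
  rw [v.map_pow, pow_two] at hle
  have : 0 < v a := hm.trans_lt hlt
  nlinarith

variable [IsDomain R] {M : Matrix (Fin 3) (Fin 3) R}

lemma ultrametric_three_points {v : AbsoluteValue R ℝ} (hv : IsNonarchimedean v)
    (hM : ∀ i j, M i j = M j i) {x y z : Fin 3 → R}
    (hx : bil M x x = 0) (hy : bil M y y = 0) (hz : bil M z z = 0)
    {nx ny nz : ℝ} (hnx : ∀ i, v (x i) ≤ nx) (hny : ∀ i, v (y i) ≤ ny) (hnz : ∀ i, v (z i) ≤ nz)
    (h1 : v (bil M y z) * nx ≤ v (bil M x y) * nz) (h2 : v (bil M x z) * ny ≤ v (bil M x y) * nz)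
    (i j : Fin 3) :
    v 2 * v (bil M x z) * v (bil M y z) * v (M.adjugate i j) ≤
      v M.det * v (bil M x y) * nz ^ 2 := by
  have hnx0 : 0 ≤ nx := (v.nonneg _).trans (hnx 0)
  have hny0 : 0 ≤ ny := (v.nonneg _).trans (hny 0)
  have hnz0 : 0 ≤ nz := (v.nonneg _).trans (hnz 0)
  set c := v (bil M x y) with hc
  have hc0 : 0 ≤ c := v.nonneg _
  have hd := congrArg v (det3_sq_mul_det_of_null hM hx hy hz)
  simp only [v.map_mul, v.map_pow] at hd
  set D := v (det3 x y z) with hD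
  have hpos : 0 ≤ v M.det * c * nz ^ 2 := by have := v.nonneg M.det; positivity
  by_cases hz0 : c = 0 ∨ D = 0
  · refine le_trans (le_of_eq ?_) hpos
    have h3 : v 2 * c * v (bil M y z) * v (bil M x z) = 0 := by
      rcases hz0 with h | h
      · rw [h]; ring
      · rw [← hd, h]; ring
    rcases eq_or_ne c 0 with h | h
    · have hxy : v (bil M x z) * ny ≤ 0 := by rw [h] at h2; linarith
      rcases eq_or_lt_of_le hny0 with h0 | h0
      · have : y = 0 := by
          funext l
          have := hny l
          rw [← h0] at this
          exact v.eq_zero.1 (le_antisymm this (v.nonneg _))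
        simp [this, bil]
      · have : v (bil M x z) = 0 := le_antisymm (by nlinarith [v.nonneg (bil M x z)]) (v.nonneg _)
        rw [this]; ring
    · have : v 2 * v (bil M x z) * v (bil M y z) = 0 := by
        have : c * (v 2 * v (bil M x z) * v (bil M y z)) = 0 := by linarith
        exact (mul_eq_zero.1 this).resolve_left h
      rw [this]; ring
  push Not at hz0
  obtain ⟨hcn, hDn⟩ := hz0
  have hc1 : 0 < c := lt_of_le_of_ne hc0 (Ne.symm hcn)
  have hadj : D ^ 2 * v (M.adjugate i j) ≤ (c * nz) ^ 2 := by
    rw [hD, ← v.map_pow, ← v.map_mul, det3_sq_mul_adjugate_of_null hM hx hy hz]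
    have hX : ∀ l, v (bil M y z * x l) ≤ c * nz := fun l => by
      rw [v.map_mul]
      exact (mul_le_mul_of_nonneg_left (hnx l) (v.nonneg _)).trans h1
    have hY : ∀ l, v (bil M x z * y l) ≤ c * nz := fun l => by
      rw [v.map_mul]
      exact (mul_le_mul_of_nonneg_left (hny l) (v.nonneg _)).trans h2
    have hZ : ∀ l, v (bil M x y * z l) ≤ c * nz := fun l => by
      rw [v.map_mul]
      exact (mul_le_mul_of_nonneg_left (hnz l) hc0)
    have hmul : ∀ {a b : R}, v a ≤ c * nz → v b ≤ c * nz → v (a * b) ≤ (c * nz) ^ 2 := by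
      intro a b ha hb
      rw [v.map_mul, pow_two]
      exact mul_le_mul ha hb (v.nonneg _) (by positivity)
    have e : -(bil M y z ^ 2 * (x i * x j)) - bil M x z ^ 2 * (y i * y j)
        - bil M x y ^ 2 * (z i * z j)
        + bil M y z * bil M x z * (x i * y j + y i * x j)
        + bil M y z * bil M x y * (x i * z j + z i * x j)
        + bil M x z * bil M x y * (y i * z j + z i * y j) =
        bil M y z * x i * (bil M x z * y j) - bil M y z * x i * (bil M y z * x j)
        - bil M x z * y i * (bil M x z * y j) - bil M x y * z i * (bil M x y * z j)
        + bil M x z * y i * (bil M y z * x j)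
        + bil M y z * x i * (bil M x y * z j) + bil M x y * z i * (bil M y z * x j)
        + bil M x z * y i * (bil M x y * z j) + bil M x y * z i * (bil M x z * y j) := by ring
    rw [e]
    repeat' first | apply ultrametric_sum_le hv | apply ultrametric_sub_le hv | apply hmul
    all_goals first | apply hX | apply hY | apply hZ
  have : c * (v 2 * v (bil M x z) * v (bil M y z) * v (M.adjugate i j)) ≤
      c * (v M.det * c * nz ^ 2) := by
    calc c * (v 2 * v (bil M x z) * v (bil M y z) * v (M.adjugate i j))
        = (v 2 * c * v (bil M y z) * v (bil M x z)) * v (M.adjugate i j) := by ring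
      _ = v M.det * (D ^ 2 * v (M.adjugate i j)) := by rw [← hd]; ring
      _ ≤ v M.det * (c * nz) ^ 2 := by have := v.nonneg M.det; gcongr
      _ = _ := by ring
  exact le_of_mul_le_mul_left this hc1

/-- If `P, Q` are at maximal distance in a family of isotropic vectors, then two vectors of the
family at the same (truncated) distance from `P` are close to each other. -/
lemma ultrametric_same_class {v : AbsoluteValue R ℝ} (hv : IsNonarchimedean v)
    (hM : ∀ i j, M i j = M j i) {P Q x y : Fin 3 → R}
    (hP : bil M P P = 0) (hQ : bil M Q Q = 0) (hx : bil M x x = 0) (hy : bil M y y = 0)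
    {nP nQ nx ny : ℝ} (hnP : ∀ i, v (P i) ≤ nP) (hnQ : ∀ i, v (Q i) ≤ nQ)
    (hnx : ∀ i, v (x i) ≤ nx) (hny : ∀ i, v (y i) ≤ ny)
    (nP0 : 0 < nP) (nQ0 : 0 < nQ) (nx0 : 0 < nx) (ny0 : 0 < ny)
    (hPx : v (bil M P x) / (nP * nx) ≤ v (bil M P Q) / (nP * nQ))
    (hQx : v (bil M Q x) / (nQ * nx) ≤ v (bil M P Q) / (nP * nQ))
    (hPy : v (bil M P y) / (nP * ny) ≤ v (bil M P Q) / (nP * nQ))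
    (hQy : v (bil M Q y) / (nQ * ny) ≤ v (bil M P Q) / (nP * nQ))
    (hPQ : bil M P Q ≠ 0) {i j : Fin 3} (hd : M.adjugate i j ≠ 0)
    (hxy : max (v (bil M P x) / (nP * nx)) (v M.det / v (M.adjugate i j)) =
      max (v (bil M P y) / (nP * ny)) (v M.det / v (M.adjugate i j))) :
    v 2 * v (bil M x y) * v (M.adjugate i j) ≤ v M.det * (nx * ny) := by
  have hd0 : 0 < v (M.adjugate i j) := v.pos hd
  have hPQ0 : 0 < v (bil M P Q) := v.pos hPQ
  set ε := v M.det / v (M.adjugate i j) with hε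
  have hε0 : 0 ≤ ε := by have := v.nonneg M.det; positivity
  have h2 := ultrametric_two_le hv
  have h20 := v.nonneg 2
  have three : ∀ {w : Fin 3 → R} {nw : ℝ}, bil M w w = 0 → (∀ i, v (w i) ≤ nw) → 0 < nw →
      v (bil M P w) / (nP * nw) ≤ v (bil M P Q) / (nP * nQ) →
      v (bil M Q w) / (nQ * nw) ≤ v (bil M P Q) / (nP * nQ) →
      v 2 * ((v (bil M P w) / (nP * nw)) * (v (bil M Q w) / (nQ * nw))) ≤
        ε * (v (bil M P Q) / (nP * nQ)) := by
    intro w nw hw hnw nw0 h1 h2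
    have := ultrametric_three_points hv hM hP hQ hw hnP hnQ hnw (by
      rw [div_le_div_iff₀ (by positivity) (by positivity)] at h2
      refine le_of_mul_le_mul_right (a := nQ) ?_ nQ0
      linarith) (by
      rw [div_le_div_iff₀ (by positivity) (by positivity)] at h1
      refine le_of_mul_le_mul_right (a := nP) ?_ nP0
      linarith) i j
    rw [hε, div_mul_div_comm, div_mul_div_comm, mul_div_assoc', div_le_div_iff₀ (by positivity) (by positivity)]
    calc _ = (v 2 * v (bil M P w) * v (bil M Q w) * v (M.adjugate i j)) * (nP * nQ) := by ring
      _ ≤ (v M.det * v (bil M P Q) * nw ^ 2) * (nP * nQ) := by gcongr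
      _ = _ := by ring
  have hpt : v (bil M P Q) * v (bil M x y) ≤
      max (v (bil M P x) * v (bil M Q y)) (v (bil M P y) * v (bil M Q x)) := by
    have := ultrametric_ptolemy hv (a := bil M P Q * bil M x y) (b := bil M P x * bil M Q y)
      (c := bil M P y * bil M Q x) (by rw [ptolemy hM hP hQ hx hy])
    simpa only [v.map_mul] using this
  have hpt' : (v (bil M P Q) / (nP * nQ)) * (v (bil M x y) / (nx * ny)) ≤
      max ((v (bil M P x) / (nP * nx)) * (v (bil M Q y) / (nQ * ny)))
        ((v (bil M P y) / (nP * ny)) * (v (bil M Q x) / (nQ * nx))) := by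
    have e1 : (v (bil M P x) / (nP * nx)) * (v (bil M Q y) / (nQ * ny)) =
      (v (bil M P x) * v (bil M Q y)) / (nP * nQ * (nx * ny)) := by field_simp
    have e2 : (v (bil M P y) / (nP * ny)) * (v (bil M Q x) / (nQ * nx)) =
      (v (bil M P y) * v (bil M Q x)) / (nP * nQ * (nx * ny)) := by field_simp
    rw [e1, e2, div_mul_div_comm]
    rcases le_max_iff.1 hpt with h | h
    · exact (div_le_div_of_nonneg_right h (by positivity)).trans (le_max_left _ _)
    · exact (div_le_div_of_nonneg_right h (by positivity)).trans (le_max_right _ _)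
  have hx3 := three hx hnx nx0 hPx hQx
  have hy3 := three hy hny ny0 hPy hQy
  have p0 : 0 < v (bil M P Q) / (nP * nQ) := by positivity
  have q1 : 0 ≤ v (bil M P x) / (nP * nx) := div_nonneg (v.nonneg _) (by positivity)
  have q2 : 0 ≤ v (bil M P y) / (nP * ny) := div_nonneg (v.nonneg _) (by positivity)
  have q3 : 0 ≤ v (bil M Q x) / (nQ * nx) := div_nonneg (v.nonneg _) (by positivity)
  have q4 : 0 ≤ v (bil M Q y) / (nQ * ny) := div_nonneg (v.nonneg _) (by positivity)
  have q5 : 0 ≤ v (bil M x y) / (nx * ny) := div_nonneg (v.nonneg _) (by positivity)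
  suffices hs : v 2 * (v (bil M x y) / (nx * ny)) ≤ ε by
    rw [hε, mul_div_assoc', div_le_div_iff₀ (by positivity) hd0] at hs
    exact hs
  clear_value ε
  generalize v (bil M P Q) / (nP * nQ) = A at *
  generalize v (bil M P x) / (nP * nx) = a at *
  generalize v (bil M P y) / (nP * ny) = b at *
  generalize v (bil M Q x) / (nQ * nx) = c at *
  generalize v (bil M Q y) / (nQ * ny) = d at *
  generalize v (bil M x y) / (nx * ny) = t at *
  generalize v 2 = s at *
  refine le_of_mul_le_mul_left ?_ p0
  rcases le_or_gt a ε with ha | ha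
  · have hb : b ≤ ε := by
      rw [max_eq_right ha] at hxy
      exact hxy ▸ le_max_left _ _
    have : A * t ≤ ε * A := hpt'.trans (max_le (mul_le_mul ha hQy q4 hε0) (mul_le_mul hb hQx q3 hε0))
    nlinarith [mul_nonneg p0.le q5]
  · have hab : a = b := by
      rw [max_eq_left ha.le] at hxy
      rcases le_total b ε with h | h
      · rw [max_eq_right h] at hxy; linarith
      · rwa [max_eq_left h] at hxy
    subst hab
    rcases le_max_iff.1 hpt' with h | h
    · nlinarith
    · nlinarith

end Ultrametric

section Archimedean

/-- The radial rescaling `u ↦ u / |u|^{1/3}` of the complex plane. -/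
def radialScale (u : ℂ) : ℂ := u * ((‖u‖ ^ (-(1 / 3) : ℝ) : ℝ) : ℂ)

lemma radialScale_mul_sqrt (u : ℂ) :
    radialScale u * (√‖radialScale u‖ : ℝ) = u := by
  rcases eq_or_ne u 0 with rfl | hu
  · simp [radialScale]
  have h : 0 < ‖u‖ := norm_pos_iff.2 hu
  have h1 : ‖radialScale u‖ = ‖u‖ ^ (2 / 3 : ℝ) := by
    rw [radialScale, norm_mul, Complex.norm_real, Real.norm_of_nonneg (by positivity)]
    nth_rewrite 1 [← Real.rpow_one ‖u‖]
    rw [← Real.rpow_add h]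
    norm_num
  rw [h1, Real.sqrt_eq_rpow, ← Real.rpow_mul h.le, radialScale, mul_assoc, ← Complex.ofReal_mul,
    ← Real.rpow_add h]
  norm_num

lemma norm_radialScale_le_one {u : ℂ} (hu : ‖u‖ ≤ 1) : ‖radialScale u‖ ≤ 1 := by
  by_contra! h
  have h2 := congrArg norm (radialScale_mul_sqrt u)
  rw [norm_mul, Complex.norm_real, Real.norm_of_nonneg (Real.sqrt_nonneg _)] at h2
  have : 1 < √‖radialScale u‖ := by
    rw [Real.lt_sqrt (by norm_num)]; simpa using h
  nlinarith

lemma norm_mul_sqrt_sub_le (a b : ℂ) :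
    ‖a * (√‖a‖ : ℝ) - b * (√‖b‖ : ℝ)‖ ≤ (√‖a‖ + √‖b‖) * ‖a - b‖ := by
  have ha := Real.sq_sqrt (norm_nonneg a)
  have hb := Real.sq_sqrt (norm_nonneg b)
  have ha0 := Real.sqrt_nonneg ‖a‖
  have hb0 := Real.sqrt_nonneg ‖b‖
  have habs : |‖a‖ - ‖b‖| ≤ ‖a - b‖ := abs_norm_sub_norm_le a b
  set s := √‖a‖
  set t := √‖b‖
  have e : a * (s : ℂ) - b * (t : ℂ) = (a - b) * (s : ℂ) + b * ((s - t : ℝ) : ℂ) := by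
    push_cast; ring
  rw [e]
  refine (norm_add_le _ _).trans ?_
  rw [norm_mul, norm_mul, Complex.norm_real, Complex.norm_real, Real.norm_of_nonneg ha0,
    Real.norm_eq_abs, ← hb]
  have h1 : t * |s - t| ≤ ‖a - b‖ := by
    refine le_trans ?_ habs
    rw [← ha, ← hb, sq_sub_sq, abs_mul, abs_of_nonneg (add_nonneg ha0 hb0)]
    exact mul_le_mul_of_nonneg_right (by linarith) (abs_nonneg _)
  nlinarith

lemma norm_vandermonde_le {κ δ : ℝ} (hκ : 0 ≤ κ) (hδ : 0 ≤ δ) {p : Fin 3 → ℝ} {u : Fin 3 → ℂ}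
    (hp0 : ∀ i, 0 ≤ p i) (hp1 : ∀ i, p i ≤ 1) (h : ∀ i, κ * ‖u i‖ * p i ≤ 1)
    (hd : ∀ i j, ‖radialScale (u i) - radialScale (u j)‖ ≤ δ) :
    κ * (p 0 * p 1 * p 2) * (‖u 0 - u 1‖ * ‖u 0 - u 2‖ * ‖u 1 - u 2‖) ≤ 8 * δ ^ 3 := by
  set s : Fin 3 → ℝ := fun i => √‖radialScale (u i)‖ with hs
  have hs0 : ∀ i, 0 ≤ s i := fun i => Real.sqrt_nonneg _
  have hs3 : ∀ i, ‖u i‖ = s i ^ 3 := fun i => by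
    have h2 := congrArg norm (radialScale_mul_sqrt (u i))
    rw [norm_mul, Complex.norm_real, Real.norm_of_nonneg (Real.sqrt_nonneg _)] at h2
    have := Real.sq_sqrt (norm_nonneg (radialScale (u i)))
    rw [← h2, ← this]
    simp only [hs, Real.sqrt_sq (Real.sqrt_nonneg _)]
    ring
  have hsub : ∀ i j, ‖u i - u j‖ ≤ (s i + s j) * δ := fun i j => by
    have := norm_mul_sqrt_sub_le (radialScale (u i)) (radialScale (u j))
    rw [radialScale_mul_sqrt, radialScale_mul_sqrt] at this
    exact this.trans (mul_le_mul_of_nonneg_left (hd i j) (add_nonneg (hs0 i) (hs0 j)))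
  obtain ⟨m, -, hm⟩ := Finset.exists_max_image Finset.univ s ⟨0, Finset.mem_univ _⟩
  have hm : ∀ i, s i ≤ s m := fun i => hm i (Finset.mem_univ _)
  have hub : ∀ i j, ‖u i - u j‖ ≤ 2 * s m * δ := fun i j =>
    (hsub i j).trans (mul_le_mul_of_nonneg_right (by linarith [hm i, hm j]) hδ)
  have hp : p 0 * p 1 * p 2 ≤ p m := by
    have h0 := hp0 0; have h1 := hp0 1; have h2 := hp0 2
    have g0 := hp1 0; have g1 := hp1 1; have g2 := hp1 2
    have h01 := mul_nonneg h0 h1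
    have h02 := mul_nonneg h0 h2
    have h12 := mul_nonneg h1 h2
    fin_cases m <;> simp only [Fin.zero_eta, Fin.mk_one, Fin.reduceFinMk]
    · nlinarith [mul_le_one₀ g1 h2 g2]
    · nlinarith [mul_le_one₀ g0 h2 g2]
    · nlinarith [mul_le_one₀ g0 h1 g1]
  have hsm := hs0 m
  have hpm := hp0 m
  calc κ * (p 0 * p 1 * p 2) * (‖u 0 - u 1‖ * ‖u 0 - u 2‖ * ‖u 1 - u 2‖)
      ≤ κ * p m * (2 * s m * δ * (2 * s m * δ) * (2 * s m * δ)) := by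
        gcongr <;> apply hub
    _ = (κ * s m ^ 3 * p m) * (8 * δ ^ 3) := by ring
    _ ≤ 1 * (8 * δ ^ 3) := by
        gcongr
        rw [← hs3]; exact h m
    _ = _ := one_mul _

variable {R : Type*} [CommRing R] {M : Matrix (Fin 3) (Fin 3) R}

lemma det3_of_vec (a b c a' b' c' a'' b'' c'' : R) :
    det3 ![a, b, c] ![a', b', c'] ![a'', b'', c''] =
      a * b' * c'' - a * c' * b'' - b * a' * c'' + b * c' * a'' + c * a' * b'' - c * b' * a'' := by
  simp [det3, Matrix.det_fin_three]

lemma exists_conic_parameter (σ : R →+* ℂ) (hM : ∀ i j, M i j = M j i)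
    (hdet : σ M.det ≠ 0) {P Q : Fin 3 → R} (hP : bil M P P = 0) (hQ : bil M Q Q = 0)
    (hPQ : σ (bil M P Q) ≠ 0) {nP nQ K : ℝ} (hnP : 0 < nP) (hnQ : 0 < nQ) (hK : 0 < K) :
    ∃ φ : (Fin 3 → R) → ℂ,
      ((∀ r : R, (σ r).im = 0) → ∀ x, (φ x).im = 0) ∧
      (∀ x, bil M x x = 0 → σ (bil M x Q) ≠ 0 →
        ‖σ (bil M x P)‖ * nQ ≤ ‖σ (bil M x Q)‖ * nP → ‖φ x‖ ≤ 1) ∧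
      ∀ (x : Fin 3 → Fin 3 → R) (nx : Fin 3 → ℝ), (∀ i, 0 < nx i) →
        (∀ i, bil M (x i) (x i) = 0) → (∀ i, σ (bil M (x i) Q) ≠ 0) →
        (∀ i, ‖σ (bil M (x i) Q)‖ * nP ≤ ‖σ (bil M P Q)‖ * nx i) →
        (∀ i, ‖σ (det3 P Q (x i))‖ ≤ K * (nP * nQ * nx i)) →
        ∀ δ : ℝ, 0 ≤ δ → (∀ i j, ‖φ (x i) - φ (x j)‖ ≤ δ) →
          ‖σ (det3 (x 0) (x 1) (x 2))‖ ≤ 8 * K * δ ^ 3 * (nx 0 * nx 1 * nx 2) := by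
  set c : ℂ := σ (bil M P Q) with hc
  set g : ℂ := σ M.det / (2 * c ^ 3) with hg
  have hg0 : g ≠ 0 := div_ne_zero hdet (mul_ne_zero two_ne_zero (pow_ne_zero _ hPQ))
  set l : ℝ := √(‖g‖ * nQ / nP) with hl
  have hgn : 0 < ‖g‖ := norm_pos_iff.2 hg0
  have hl0 : 0 < l := Real.sqrt_pos.2 (by positivity)
  have hl2 : l ^ 2 = ‖g‖ * nQ / nP := Real.sq_sqrt (by positivity)
  set p : (Fin 3 → R) → ℂ := fun x => σ (bil M x Q) / c with hp
  set t : (Fin 3 → R) → ℂ := fun x => σ (det3 P Q x) / p x with ht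
  have hq : ∀ x, bil M x x = 0 → σ (bil M x Q) ≠ 0 →
      σ (bil M x P) / c = g * t x ^ 2 * p x := by
    intro x hx hxQ
    have h := congrArg σ (det3_sq_mul_det_of_null hM hP hQ hx)
    simp only [map_mul, map_pow, map_ofNat] at h
    rw [bil_comm hM Q x, bil_comm hM P x] at h
    simp only [hg, ht, hp]
    field_simp
    linear_combination -h
  refine ⟨fun x => radialScale (t x * l), ?_, ?_, ?_⟩
  · intro hre x
    have h1 : (t x).im = 0 := by
      have hr : ∀ r : R, σ r = ((σ r).re : ℂ) := fun r => Complex.ext rfl (by simpa using hre r)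
      simp only [ht, hp, hc]
      rw [hr (det3 P Q x), hr (bil M x Q), hr (bil M P Q), ← Complex.ofReal_div,
        ← Complex.ofReal_div, Complex.ofReal_im]
    simp [radialScale, h1]
  · intro x hx hxQ hle
    apply norm_radialScale_le_one
    have hpx : p x ≠ 0 := div_ne_zero hxQ hPQ
    have hpn : 0 < ‖p x‖ := norm_pos_iff.2 hpx
    have h1 : ‖g‖ * ‖t x‖ ^ 2 * ‖p x‖ * nQ ≤ ‖p x‖ * nP := by
      rw [← norm_pow, ← norm_mul, ← norm_mul, ← hq x hx hxQ]
      simp only [hp, norm_div]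
      rw [div_mul_eq_mul_div, div_mul_eq_mul_div]
      gcongr
    have h2 : (‖t x‖ * l) ^ 2 ≤ 1 := by
      rw [mul_pow, hl2, mul_div_assoc', div_le_one hnP]
      refine le_of_mul_le_mul_right ?_ hpn
      nlinarith
    rw [norm_mul, Complex.norm_real, Real.norm_of_nonneg hl0.le]
    nlinarith [mul_nonneg (norm_nonneg (t x)) hl0.le]
  · intro x nx hnx hx hxQ hpn hr δ hδ hφ
    have hpx : ∀ i, p (x i) ≠ 0 := fun i => div_ne_zero (hxQ i) hPQ
    set κ : ℝ := ‖g‖ / (nP ^ 3 * l ^ 3 * K) with hκ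
    set p' : Fin 3 → ℝ := fun i => ‖p (x i)‖ * nP / nx i with hp'
    have hcn : 0 < ‖c‖ := norm_pos_iff.2 hPQ
    have key := norm_vandermonde_le (κ := κ) (p := p') (u := fun i => t (x i) * l)
      (by positivity) hδ (fun i => by have := hnx i; positivity) (fun i => by
        have := hnx i
        simp only [hp', hp, norm_div]
        rw [div_le_one (hnx i), div_mul_eq_mul_div, div_le_iff₀ hcn]
        linarith [hpn i]) (fun i => by
        have h0 := hnx i
        have h1 : ‖t (x i)‖ * ‖p (x i)‖ ≤ K * (nP * nQ * nx i) := by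
          rw [← norm_mul]
          simp only [ht]
          rw [div_mul_cancel₀ _ (hpx i)]
          exact hr i
        rw [norm_mul, Complex.norm_real, Real.norm_of_nonneg hl0.le]
        calc κ * (‖t (x i)‖ * l) * p' i
            = κ * l * nP / nx i * (‖t (x i)‖ * ‖p (x i)‖) := by simp only [hp']; ring
          _ ≤ κ * l * nP / nx i * (K * (nP * nQ * nx i)) := by gcongr
          _ = (‖g‖ * nQ / nP) / l ^ 2 := by simp only [hκ]; field_simp
          _ ≤ 1 := by rw [hl2, div_self (by rw [← hl2]; positivity)]) hφ
    have hD : σ (det3 (x 0) (x 1) (x 2)) = g * (p (x 0) * p (x 1) * p (x 2)) *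
        ((t (x 0) - t (x 1)) * (t (x 0) - t (x 2)) * (t (x 1) - t (x 2))) := by
      have h := congrArg σ (det3_mul_bil_sq hM hP (Q := Q) (x 0) (x 1) (x 2))
      have hQx : ∀ i, σ (bil M (x i) Q) = c * p (x i) := fun i => by
        simp only [hp]; field_simp
      have hPx : ∀ i, σ (bil M (x i) P) = c * (g * t (x i) ^ 2 * p (x i)) := fun i => by
        rw [← hq _ (hx i) (hxQ i)]; field_simp
      have hrx : ∀ i, σ (det3 P Q (x i)) = t (x i) * p (x i) := fun i => by
        simp only [ht]; rw [div_mul_cancel₀ _ (hpx i)]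
      rw [det3_of_vec] at h
      simp only [map_mul, map_sub, map_add, map_pow, hQx, hPx, hrx] at h
      refine mul_right_cancel₀ (pow_ne_zero 2 hPQ) ?_
      rw [← hc] at h
      refine h.trans ?_
      ring
    rw [hD]
    simp only [norm_mul]
    have e : ∀ i j, ‖t (x i) * (l : ℂ) - t (x j) * (l : ℂ)‖ = ‖t (x i) - t (x j)‖ * l :=
      fun i j => by
        rw [← sub_mul, norm_mul, Complex.norm_real, Real.norm_of_nonneg hl0.le]
    simp only [e] at key
    have h0 := hnx 0
    have h1 := hnx 1
    have h2 := hnx 2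
    calc ‖g‖ * (‖p (x 0)‖ * ‖p (x 1)‖ * ‖p (x 2)‖) *
          (‖t (x 0) - t (x 1)‖ * ‖t (x 0) - t (x 2)‖ * ‖t (x 1) - t (x 2)‖)
        = K * (nx 0 * nx 1 * nx 2) * (κ * (p' 0 * p' 1 * p' 2) *
          (‖t (x 0) - t (x 1)‖ * l * (‖t (x 0) - t (x 2)‖ * l) * (‖t (x 1) - t (x 2)‖ * l))) := by
          simp only [hκ, hp']; field_simp
      _ ≤ K * (nx 0 * nx 1 * nx 2) * (8 * δ ^ 3) := by gcongr
      _ = _ := by ring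

end Archimedean

section ArchimedeanClasses
variable {R : Type*} [CommRing R] {M : Matrix (Fin 3) (Fin 3) R}

lemma det3_self_left (x y : Fin 3 → R) : det3 x x y = 0 := by
  simp [det3, Matrix.det_fin_three]; ring

lemma norm_sub_le_of_floor_eq {u v : ℂ} {L : ℕ} (hL : 1 ≤ L)
    (h1 : ⌊(L : ℝ) * u.re⌋ = ⌊(L : ℝ) * v.re⌋) (h2 : ⌊(L : ℝ) * u.im⌋ = ⌊(L : ℝ) * v.im⌋) :
    ‖u - v‖ ≤ 2 / L := by
  have hL0 : (0 : ℝ) < L := by exact_mod_cast hL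
  have hre := (Int.abs_sub_lt_one_of_floor_eq_floor h1).le
  have him := (Int.abs_sub_lt_one_of_floor_eq_floor h2).le
  rw [← mul_sub, abs_mul, abs_of_pos hL0] at hre him
  have := Complex.norm_le_abs_re_add_abs_im (u - v)
  rw [Complex.sub_re, Complex.sub_im] at this
  rw [le_div_iff₀ hL0]
  nlinarith

lemma floor_mem_Icc {x : ℝ} {L : ℕ} (h : |x| ≤ 1) : ⌊(L : ℝ) * x⌋ ∈ Finset.Icc (-(L : ℤ)) L := by
  obtain ⟨h1, h2⟩ := abs_le.1 h
  have hL0 : (0 : ℝ) ≤ L := L.cast_nonneg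
  rw [Finset.mem_Icc, Int.le_floor]
  refine ⟨by push_cast; nlinarith, ?_⟩
  have h3 : (⌊(L : ℝ) * x⌋ : ℝ) ≤ L := (Int.floor_le _).trans (by nlinarith)
  exact_mod_cast h3

/-- Isotropic vectors can be sorted into `O(L^m)` classes (`m = 1` at a real place and `m = 2` at a
complex one) such that the determinant of any triple in a common class gains a factor `L^{-3}`. -/
lemma exists_archimedean_classes (σ : R →+* ℂ) (hσ : Function.Injective σ)
    (hM : ∀ i j, M i j = M j i) (hdet : M.det ≠ 0) (S : Finset (Fin 3 → R))
    (hnull : ∀ x ∈ S, bil M x x = 0) (hne : ∀ x ∈ S, ∀ y ∈ S, x ≠ y → bil M x y ≠ 0)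
    (N : (Fin 3 → R) → ℝ) (hN : ∀ x ∈ S, 0 < N x) {K : ℝ} (hK : 0 < K)
    (hD : ∀ x ∈ S, ∀ y ∈ S, ∀ z ∈ S, ‖σ (det3 x y z)‖ ≤ K * (N x * N y * N z))
    {m : ℕ} (hm : m = 2 ∨ m = 1 ∧ ∀ r, (σ r).im = 0) {L : ℕ} (hL : 1 ≤ L) :
    ∃ (cl : (Fin 3 → R) → Bool × ℤ × ℤ) (T : Finset (Bool × ℤ × ℤ)), T.card ≤ 18 * L ^ m ∧
      (∀ x ∈ S, cl x ∈ T) ∧ ∀ x : Fin 3 → Fin 3 → R, (∀ i, x i ∈ S) →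
        (∀ i j, cl (x i) = cl (x j)) →
        ‖σ (det3 (x 0) (x 1) (x 2))‖ ≤ 64 * K / L ^ 3 * (N (x 0) * N (x 1) * N (x 2)) := by
  classical
  have hL0 : (0 : ℝ) < L := by exact_mod_cast hL
  have hσ0 : ∀ {r : R}, r ≠ 0 → σ r ≠ 0 := fun h => by rwa [Ne, map_eq_zero_iff σ hσ]
  by_cases hS : ∃ P ∈ S, ∃ Q ∈ S, P ≠ Q
  swap
  · push Not at hS
    refine ⟨fun _ => (true, 0, 0), {(true, 0, 0)}, ?_, fun x _ => by simp, ?_⟩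
    · rw [Finset.card_singleton]
      have := Nat.one_le_pow m L hL
      omega
    · intro x hx _
      rw [hS _ (hx 0) _ (hx 1), det3_self_left, map_zero, norm_zero]
      have h0 := hN _ (hx 0)
      have h1 := hN _ (hx 1)
      have h2 := hN _ (hx 2)
      positivity
  obtain ⟨P₀, hP₀, Q₀, hQ₀, hPQ₀⟩ := hS
  obtain ⟨⟨P, Q⟩, hPQS, hmax⟩ := Finset.exists_max_image (S ×ˢ S)
    (fun w => ‖σ (bil M w.1 w.2)‖ / (N w.1 * N w.2)) ⟨(P₀, Q₀), by simp [hP₀, hQ₀]⟩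
  obtain ⟨hPS, hQS⟩ := Finset.mem_product.1 hPQS
  simp only at hPS hQS
  have hmax : ∀ x ∈ S, ∀ y ∈ S,
      ‖σ (bil M x y)‖ / (N x * N y) ≤ ‖σ (bil M P Q)‖ / (N P * N Q) := fun x hx y hy =>
    hmax (x, y) (Finset.mem_product.2 ⟨hx, hy⟩)
  have hnP := hN P hPS
  have hnQ := hN Q hQS
  have hPQ : P ≠ Q := by
    rintro rfl
    have h1 := hmax _ hP₀ _ hQ₀
    rw [hnull P hPS, map_zero, norm_zero, zero_div] at h1
    have h2 := norm_pos_iff.2 (hσ0 (hne _ hP₀ _ hQ₀ hPQ₀))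
    have h3 := hN _ hP₀
    have h4 := hN _ hQ₀
    have : 0 < ‖σ (bil M P₀ Q₀)‖ / (N P₀ * N Q₀) := by positivity
    linarith
  have hB := hne P hPS Q hQS hPQ
  have hB' := hne Q hQS P hPS hPQ.symm
  have hxQ : ∀ x ∈ S, ‖σ (bil M x Q)‖ * N P ≤ ‖σ (bil M P Q)‖ * N x := fun x hx => by
    have h1 := hmax x hx Q hQS
    have h2 := hN x hx
    rw [div_le_div_iff₀ (by positivity) (by positivity)] at h1
    exact le_of_mul_le_mul_right (by linarith) hnQ
  have hxP : ∀ x ∈ S, ‖σ (bil M x P)‖ * N Q ≤ ‖σ (bil M Q P)‖ * N x := fun x hx => by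
    have h1 := hmax x hx P hPS
    have h2 := hN x hx
    rw [bil_comm hM P Q, div_le_div_iff₀ (by positivity) (by positivity)] at h1
    exact le_of_mul_le_mul_right (by linarith) hnP
  obtain ⟨φ₁, hre₁, hle₁, hd₁⟩ := exists_conic_parameter σ hM (hσ0 hdet) (hnull P hPS)
    (hnull Q hQS) (hσ0 hB) hnP hnQ hK
  obtain ⟨φ₂, hre₂, hle₂, hd₂⟩ := exists_conic_parameter σ hM (hσ0 hdet) (hnull Q hQS)
    (hnull P hPS) (hσ0 hB') hnQ hnP hK
  set b : (Fin 3 → R) → Prop := fun x => ‖σ (bil M x P)‖ * N Q ≤ ‖σ (bil M x Q)‖ * N P with hb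
  have hbQ : ∀ x ∈ S, b x → σ (bil M x Q) ≠ 0 := fun x hx h h0 => by
    simp only [hb, h0, norm_zero, zero_mul] at h
    have h1 : x = Q := by
      by_contra hne'
      exact hσ0 (hne x hx Q hQS hne') h0
    subst h1
    have := norm_pos_iff.2 (hσ0 hB')
    nlinarith
  have hbP : ∀ x ∈ S, ¬ b x → σ (bil M x P) ≠ 0 := fun x hx h h0 => by
    apply h
    simp only [hb, h0, norm_zero, zero_mul]
    positivity
  set φ : (Fin 3 → R) → ℂ := fun x => if b x then φ₁ x else φ₂ x with hφ
  have hφ1 : ∀ x ∈ S, ‖φ x‖ ≤ 1 := fun x hx => by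
    by_cases h : b x
    · simp only [hφ, if_pos h]
      exact hle₁ x (hnull x hx) (hbQ x hx h) h
    · simp only [hφ, if_neg h]
      exact hle₂ x (hnull x hx) (hbP x hx h) (le_of_lt (not_le.1 h))
  refine ⟨fun x => (decide (b x), ⌊(L : ℝ) * (φ x).re⌋, ⌊(L : ℝ) * (φ x).im⌋),
    Finset.univ ×ˢ (Finset.Icc (-(L : ℤ)) L ×ˢ
      if m = 2 then Finset.Icc (-(L : ℤ)) L else {0}), ?_, ?_, ?_⟩
  · have hcard : (Finset.Icc (-(L : ℤ)) L).card = 2 * L + 1 := by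
      rw [Int.card_Icc]; omega
    rw [Finset.card_product, Finset.card_product, hcard]
    rcases hm with rfl | ⟨rfl, -⟩
    · simp only [if_true, hcard, Finset.card_univ, Fintype.card_bool]
      nlinarith
    · simp only [Finset.card_univ, Fintype.card_bool]
      norm_num
      omega
  · intro x hx
    simp only [Finset.mem_product, Finset.mem_univ, true_and]
    refine ⟨floor_mem_Icc ((Complex.abs_re_le_norm _).trans (hφ1 x hx)), ?_⟩
    rcases hm with rfl | ⟨rfl, hr⟩
    · rw [if_pos rfl]
      exact floor_mem_Icc ((Complex.abs_im_le_norm _).trans (hφ1 x hx))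
    · have : (φ x).im = 0 := by
        by_cases h : b x
        · simp only [hφ, if_pos h]; exact hre₁ hr x
        · simp only [hφ, if_neg h]; exact hre₂ hr x
      simp [this]
  · intro x hx hcl
    simp only [Prod.mk.injEq, decide_eq_decide] at hcl
    have hclose : ∀ i j, ‖φ (x i) - φ (x j)‖ ≤ 2 / L := fun i j =>
      norm_sub_le_of_floor_eq hL (hcl i j).2.1 (hcl i j).2.2
    have hfin : 8 * K * (2 / (L : ℝ)) ^ 3 = 64 * K / L ^ 3 := by field_simp; norm_num
    rw [← hfin]
    by_cases h : b (x 0)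
    · have hall : ∀ i, b (x i) := fun i => (hcl 0 i).1.1 h
      have e : ∀ i, φ (x i) = φ₁ (x i) := fun i => by simp only [hφ, if_pos (hall i)]
      refine hd₁ x (fun i => N (x i)) (fun i => hN _ (hx i)) (fun i => hnull _ (hx i))
        (fun i => hbQ _ (hx i) (hall i)) (fun i => hxQ _ (hx i))
        (fun i => hD _ hPS _ hQS _ (hx i)) _ (by positivity) fun i j => ?_
      rw [← e, ← e]; exact hclose i j
    · have hall : ∀ i, ¬ b (x i) := fun i hi => h ((hcl i 0).1.1 hi)
      have e : ∀ i, φ (x i) = φ₂ (x i) := fun i => by simp only [hφ, if_neg (hall i)]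
      refine hd₂ x (fun i => N (x i)) (fun i => hN _ (hx i)) (fun i => hnull _ (hx i))
        (fun i => hbP _ (hx i) (hall i)) (fun i => hxP _ (hx i))
        (fun i => hD _ hQS _ hPS _ (hx i)) _ (by positivity) fun i j => ?_
      rw [← e, ← e]; exact hclose i j

end ArchimedeanClasses

section IdealAbs
open UniqueFactorizationMonoid
open scoped Classical in
/-- The exponent of the prime `v` in the factorization of an ideal. -/
def idealOrd {R : Type*} [CommRing R] [IsDedekindDomain R] (v : HeightOneSpectrum R)
    (I : Ideal R) : ℕ :=
  (normalizedFactors I).count v.asIdeal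

variable {F : Type*} [Field F] [NumberField F] (v : HeightOneSpectrum (𝓞 F))

/-- The normalized absolute value on `𝓞 F` attached to a prime. -/
def finAbs : AbsoluteValue (𝓞 F) ℝ :=
  v.intAdicAbv (NumberField.HeightOneSpectrum.one_lt_absNorm_nnreal v)

open scoped Classical in
/-- The normalized absolute value of an ideal at a prime. -/
def idealAbs (I : Ideal (𝓞 F)) : ℝ :=
  if I = ⊥ then 0 else ((Ideal.absNorm v.asIdeal : ℝ)⁻¹) ^ idealOrd v I

lemma isNonarchimedean_finAbs : IsNonarchimedean (finAbs v) :=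
  v.isNonarchimedean_intAdicAbv _

lemma one_lt_absNorm_real : 1 < (Ideal.absNorm v.asIdeal : ℝ) := by
  exact_mod_cast NumberField.HeightOneSpectrum.one_lt_absNorm v

lemma idealOrd_mul {I J : Ideal (𝓞 F)} (hI : I ≠ ⊥) (hJ : J ≠ ⊥) :
    idealOrd v (I * J) = idealOrd v I + idealOrd v J := by
  classical
  rw [idealOrd, normalizedFactors_mul hI hJ, Multiset.count_add]
  rfl

lemma idealOrd_eq_multiplicity {I : Ideal (𝓞 F)} (hI : I ≠ ⊥) :
    idealOrd v I = multiplicity v.asIdeal I := by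
  classical
  rw [idealOrd, multiplicity_eq_count_normalizedFactors v.irreducible hI, normalize_eq]

lemma finAbs_eq_idealAbs (r : 𝓞 F) : finAbs v r = idealAbs v (Ideal.span {r}) := by
  rcases eq_or_ne r 0 with rfl | hr
  · simp [idealAbs]
  have hsr : Ideal.span {r} ≠ ⊥ := Submodule.span_singleton_eq_bot.mp.mt hr
  rw [idealAbs, if_neg hsr, idealOrd_eq_multiplicity v hsr]
  simp only [finAbs, HeightOneSpectrum.intAdicAbv, HeightOneSpectrum.intAdicAbvDef,
    AbsoluteValue.coe_mk, MulHom.coe_mk, v.intValuation_eq_exp_neg_multiplicity hr]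
  rw [WithZeroMulInt.toNNReal_neg_apply _ WithZero.exp_ne_zero]
  have : WithZero.unzero (WithZero.exp_ne_zero
      (a := (-(multiplicity v.asIdeal (Ideal.span {r}) : ℤ)))) =
      Multiplicative.ofAdd (-(multiplicity v.asIdeal (Ideal.span {r}) : ℤ)) := rfl
  rw [this]
  simp

lemma idealAbs_bot : idealAbs v (⊥ : Ideal (𝓞 F)) = 0 := if_pos rfl

lemma idealAbs_pos {I : Ideal (𝓞 F)} (hI : I ≠ ⊥) : 0 < idealAbs v I := by
  rw [idealAbs, if_neg hI]
  have := one_lt_absNorm_real v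
  positivity

lemma idealAbs_nonneg (I : Ideal (𝓞 F)) : 0 ≤ idealAbs v I := by
  rcases eq_or_ne I ⊥ with rfl | hI
  · rw [idealAbs_bot]
  · exact (idealAbs_pos v hI).le

lemma idealAbs_mul (I J : Ideal (𝓞 F)) :
    idealAbs v (I * J) = idealAbs v I * idealAbs v J := by
  rcases eq_or_ne I ⊥ with rfl | hI
  · simp [idealAbs_bot]
  rcases eq_or_ne J ⊥ with rfl | hJ
  · simp [idealAbs_bot]
  have hIJ : I * J ≠ ⊥ := mul_ne_zero hI hJ
  rw [idealAbs, idealAbs, idealAbs, if_neg hI, if_neg hJ, if_neg hIJ, idealOrd_mul v hI hJ, pow_add]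

lemma idealAbs_pow (I : Ideal (𝓞 F)) (m : ℕ) : idealAbs v (I ^ m) = idealAbs v I ^ m := by
  induction m with
  | zero =>
    have h : (1 : Ideal (𝓞 F)) ≠ ⊥ := one_ne_zero
    rw [pow_zero, pow_zero, idealAbs, if_neg h, idealOrd, normalizedFactors_one,
      Multiset.count_zero, pow_zero]
  | succ m ih => rw [pow_succ, pow_succ, idealAbs_mul, ih]

lemma idealAbs_le_idealAbs_iff {I J : Ideal (𝓞 F)} (hI : I ≠ ⊥) (hJ : J ≠ ⊥) :
    idealAbs v I ≤ idealAbs v J ↔ idealOrd v J ≤ idealOrd v I := by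
  have h := one_lt_absNorm_real v
  rw [idealAbs, idealAbs, if_neg hI, if_neg hJ]
  exact pow_le_pow_iff_right_of_lt_one₀ (by positivity) (inv_lt_one_of_one_lt₀ h)

lemma idealOrd_le_of_dvd {I J : Ideal (𝓞 F)} (hJ : J ≠ ⊥) (h : I ∣ J) :
    idealOrd v I ≤ idealOrd v J := by
  classical
  obtain ⟨K, rfl⟩ := h
  rw [idealOrd_mul v (left_ne_zero_of_mul hJ) (right_ne_zero_of_mul hJ)]
  omega

lemma idealAbs_le_of_le {I J : Ideal (𝓞 F)} (h : I ≤ J) : idealAbs v I ≤ idealAbs v J := by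
  rcases eq_or_ne I ⊥ with rfl | hI
  · rw [idealAbs_bot]; exact idealAbs_nonneg v J
  · rw [idealAbs_le_idealAbs_iff v hI (ne_bot_of_le_ne_bot hI h)]
    exact idealOrd_le_of_dvd v hI (Ideal.dvd_iff_le.2 h)

lemma finAbs_le_of_mem {I : Ideal (𝓞 F)} {r : 𝓞 F} (h : r ∈ I) : finAbs v r ≤ idealAbs v I := by
  rw [finAbs_eq_idealAbs]
  exact idealAbs_le_of_le v ((Ideal.span_singleton_le_iff_mem I).2 h)

lemma exists_finAbs_eq_idealAbs (I : Ideal (𝓞 F)) : ∃ r ∈ I, finAbs v r = idealAbs v I := by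
  rcases eq_or_ne I ⊥ with rfl | hI
  · exact ⟨0, by simp, by simp [idealAbs_bot]⟩
  have h1 : ¬ I ≤ I * v.asIdeal := fun h => by
    have h2 := idealOrd_le_of_dvd v hI (Ideal.dvd_iff_le.2 h)
    rw [idealOrd_mul v hI v.ne_bot] at h2
    have h3 : idealOrd v v.asIdeal = 1 := by
      rw [idealOrd, normalizedFactors_irreducible v.irreducible, normalize_eq]
      simp
    omega
  obtain ⟨r, hr, hrv⟩ := Set.not_subset.1 h1
  refine ⟨r, hr, (finAbs_le_of_mem v hr).antisymm ?_⟩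
  have hr0 : r ≠ 0 := fun h => hrv (h ▸ Submodule.zero_mem _)
  have hsr : Ideal.span {r} ≠ ⊥ := Submodule.span_singleton_eq_bot.mp.mt hr0
  rw [finAbs_eq_idealAbs, idealAbs_le_idealAbs_iff v hI hsr]
  obtain ⟨K, hK⟩ := Ideal.dvd_iff_le.2 ((Ideal.span_singleton_le_iff_mem I).2 hr)
  have hK0 : K ≠ ⊥ := by rintro rfl; simp at hK; exact hr0 hK
  rw [hK, idealOrd_mul v hI hK0]
  by_contra! hlt
  apply hrv
  have hd : v.asIdeal ∣ K := by
    have : v.asIdeal ∈ normalizedFactors K := by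
      classical
      rw [← Multiset.count_pos]
      have : 0 < idealOrd v K := by omega
      exact this
    exact dvd_of_mem_normalizedFactors this
  have : I * v.asIdeal ∣ Ideal.span {r} := hK ▸ mul_dvd_mul_left I hd
  exact Ideal.dvd_span_singleton.1 this

lemma idealAbs_sup (I J : Ideal (𝓞 F)) : idealAbs v (I ⊔ J) = max (idealAbs v I) (idealAbs v J) := by
  apply le_antisymm
  · obtain ⟨r, hr, h⟩ := exists_finAbs_eq_idealAbs v (I ⊔ J)
    obtain ⟨a, ha, b, hb, rfl⟩ := Submodule.mem_sup.1 hr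
    rw [← h]
    exact (isNonarchimedean_finAbs v a b).trans
      (max_le_max (finAbs_le_of_mem v ha) (finAbs_le_of_mem v hb))
  · exact max_le (idealAbs_le_of_le v le_sup_left) (idealAbs_le_of_le v le_sup_right)

lemma dvd_of_idealAbs_le {I J : Ideal (𝓞 F)} (hI : I ≠ ⊥)
    (h : ∀ v, idealAbs v J ≤ idealAbs v I) : I ∣ J := by
  classical
  rcases eq_or_ne J ⊥ with rfl | hJ
  · exact dvd_zero I
  rw [dvd_iff_normalizedFactors_le_normalizedFactors hI hJ, Multiset.le_iff_count]
  intro p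
  by_cases hp : p ∈ normalizedFactors I
  · have hp' := prime_of_normalized_factor p hp
    exact (idealAbs_le_idealAbs_iff _ hJ hI).1
      (h ⟨p, Ideal.isPrime_of_prime hp', hp'.ne_zero⟩)
  · rw [Multiset.count_eq_zero_of_notMem hp]
    exact Nat.zero_le _

/-- In a family of generators, one attains the absolute value of the ideal. -/
lemma exists_mem_finAbs_eq_idealAbs_span {s : Set (𝓞 F)} (hs : s.Finite) (hne : s.Nonempty) :
    ∃ d ∈ s, finAbs v d = idealAbs v (Ideal.span s) := by
  obtain ⟨d, hd, hmax⟩ := Set.exists_max_image s (finAbs v) hs hne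
  refine ⟨d, hd, (finAbs_le_of_mem v (Ideal.subset_span hd)).antisymm ?_⟩
  obtain ⟨r, hr, h⟩ := exists_finAbs_eq_idealAbs v (Ideal.span s)
  rw [← h]
  clear h
  have hle : ∀ r : 𝓞 F, finAbs v r ≤ 1 := fun r => v.intAdicAbv_le_one _ r
  induction hr using Submodule.span_induction with
  | mem x hx => exact hmax x hx
  | zero => rw [map_zero]; exact (finAbs v).nonneg d
  | add x y _ _ hx hy => exact (isNonarchimedean_finAbs v x y).trans (max_le hx hy)
  | smul a x _ hx =>
    rw [smul_eq_mul, (finAbs v).map_mul]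
    nlinarith [hle a, (finAbs v).nonneg x, (finAbs v).nonneg a]

/-- A family of exponent vectors bounded by an ideal `D` is encoded by divisors of `D`. -/
lemma exists_dvd_of_exponents {X : Type*} {D : Ideal (𝓞 F)} (c : X → HeightOneSpectrum (𝓞 F) → ℕ)
    (hc : ∀ x v, c x v ≤ idealOrd v D) :
    ∃ J : X → Ideal (𝓞 F), (∀ x, J x ∣ D) ∧ ∀ x y, J x = J y → ∀ v, c x v = c y v := by
  classical
  by_cases hD : D = ⊥
  · refine ⟨fun _ => 1, fun _ => one_dvd _, fun x y _ v => ?_⟩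
    have : idealOrd v D = 0 := by
      rw [idealOrd, hD, show (⊥ : Ideal (𝓞 F)) = 0 from rfl, normalizedFactors_zero]
      exact Multiset.count_zero _
    have := hc x v
    have := hc y v
    omega
  set S := normalizedFactors D
  set c' : X → Ideal (𝓞 F) → ℕ := fun x p =>
    if h : p.IsPrime ∧ p ≠ ⊥ then c x ⟨p, h.1, h.2⟩ else 0 with hc'
  set s : X → Multiset (Ideal (𝓞 F)) := fun x => ∑ p ∈ S.toFinset, Multiset.replicate (c' x p) p
    with hs
  have hcount : ∀ x p, (s x).count p = if p ∈ S then c' x p else 0 := by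
    intro x p
    simp only [hs, Multiset.count_sum', Multiset.count_replicate]
    simp
  have hle : ∀ x, s x ≤ S := fun x => by
    rw [Multiset.le_iff_count]
    intro p
    rw [hcount]
    split_ifs with hp
    · simp only [hc']
      split_ifs with h
      · exact hc x ⟨p, h.1, h.2⟩
      · exact Nat.zero_le _
    · exact Nat.zero_le _
  have hnf : ∀ x, normalizedFactors (s x).prod = s x := fun x => by
    rw [normalizedFactors_prod_of_prime]
    · intro p hp
      exact prime_of_normalized_factor p (Multiset.mem_of_le (hle x) hp)
  refine ⟨fun x => (s x).prod, fun x => ?_, fun x y hxy v => ?_⟩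
  · have := Multiset.prod_dvd_prod_of_le (hle x)
    rwa [Ideal.prod_normalizedFactors_eq_self hD] at this
  · have hxy' : s x = s y := by rw [← hnf x, ← hnf y]; exact congrArg _ hxy
    have h := congrArg (Multiset.count v.asIdeal) hxy'
    rw [hcount, hcount] at h
    split_ifs at h with hv
    · simpa [hc', v.isPrime, v.ne_bot] using h
    · have h0 : idealOrd v D = 0 := Multiset.count_eq_zero_of_notMem hv
      have := hc x v
      have := hc y v
      omega

lemma hasFiniteMulSupport_idealAbs {I : Ideal (𝓞 F)} (hI : I ≠ ⊥) :
    (fun v : HeightOneSpectrum (𝓞 F) => idealAbs v I).HasFiniteMulSupport := by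
  simp only [idealAbs, if_neg hI, idealOrd_eq_multiplicity _ hI]
  exact hasFiniteMulSupport_fun_pow_multiplicity
    (fun v : HeightOneSpectrum (𝓞 F) => ((Ideal.absNorm v.asIdeal : ℝ)⁻¹))
    (g := fun v => v.asIdeal) (fun _ _ h => HeightOneSpectrum.ext h) (fun v => v.irreducible) hI

lemma finprod_idealAbs {I : Ideal (𝓞 F)} (hI : I ≠ ⊥) :
    ∏ᶠ v : HeightOneSpectrum (𝓞 F), idealAbs v I = ((Ideal.absNorm I : ℝ))⁻¹ := by
  have h1 : (Ideal.absNorm I : ℝ) = ∏ᶠ v : HeightOneSpectrum (𝓞 F),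
      (Ideal.absNorm v.asIdeal : ℝ) ^ multiplicity v.asIdeal I := by
    conv_lhs => rw [← Ideal.finprod_heightOneSpectrum_pow_multiplicity hI]
    refine (MonoidHom.map_finprod ((Nat.castRingHom ℝ).toMonoidHom.comp
      (Ideal.absNorm (S := 𝓞 F)).toMonoidHom) ?_).trans ?_
    · exact hasFiniteMulSupport_fun_pow_multiplicity (fun v : HeightOneSpectrum (𝓞 F) => v.asIdeal)
        (g := fun v => v.asIdeal) (fun _ _ h => HeightOneSpectrum.ext h) (fun v => v.irreducible) hI
    · simp
  rw [h1, ← finprod_inv_distrib]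
  simp only [idealAbs, if_neg hI, idealOrd_eq_multiplicity _ hI, inv_pow]

end IdealAbs

section FiniteClasses

/-- The `2 × 2` minors of a matrix. -/
def minorSet {R : Type*} [CommRing R] (M : Matrix (Fin 3) (Fin 3) R) : Set R :=
  {d | ∃ i₀ i₁ j₀ j₁ : Fin 3, i₀ ≠ i₁ ∧ j₀ ≠ j₁ ∧ d = M i₀ j₀ * M i₁ j₁ - M i₀ j₁ * M i₁ j₀}

lemma finite_minorSet {R : Type*} [CommRing R] (M : Matrix (Fin 3) (Fin 3) R) :
    (minorSet M).Finite := by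
  refine (Set.finite_range fun i : Fin 3 × Fin 3 × Fin 3 × Fin 3 =>
    M i.1 i.2.2.1 * M i.2.1 i.2.2.2 - M i.1 i.2.2.2 * M i.2.1 i.2.2.1).subset ?_
  rintro d ⟨i₀, i₁, j₀, j₁, -, -, rfl⟩
  exact ⟨(i₀, i₁, j₀, j₁), rfl⟩

lemma det_mem_span_minorSet {R : Type*} [CommRing R] (M : Matrix (Fin 3) (Fin 3) R) :
    M.det ∈ Ideal.span (minorSet M) := by
  have h : ∀ {j₀ j₁ : Fin 3}, j₀ ≠ j₁ →
      M 1 j₀ * M 2 j₁ - M 1 j₁ * M 2 j₀ ∈ Ideal.span (minorSet M) := fun hj =>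
    Ideal.subset_span ⟨1, 2, _, _, by decide, hj, rfl⟩
  have e : M.det = M 0 0 * (M 1 1 * M 2 2 - M 1 2 * M 2 1) -
      M 0 1 * (M 1 0 * M 2 2 - M 1 2 * M 2 0) + M 0 2 * (M 1 0 * M 2 1 - M 1 1 * M 2 0) := by
    rw [Matrix.det_fin_three]; ring
  rw [e]
  exact add_mem (sub_mem (Ideal.mul_mem_left _ _ (h (by decide)))
    (Ideal.mul_mem_left _ _ (h (by decide)))) (Ideal.mul_mem_left _ _ (h (by decide)))

variable {F : Type*} [Field F] [NumberField F]

/-- The ideal generated by the coordinates of a vector. -/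
def contentIdeal {ι : Type*} (x : ι → 𝓞 F) : Ideal (𝓞 F) := Ideal.span (Set.range x)

lemma mem_contentIdeal {ι : Type*} (x : ι → 𝓞 F) (i : ι) : x i ∈ contentIdeal x :=
  Ideal.subset_span ⟨i, rfl⟩

lemma contentIdeal_ne_bot {ι : Type*} {x : ι → 𝓞 F} (hx : x ≠ 0) : contentIdeal x ≠ ⊥ := by
  intro h
  apply hx
  ext1 i
  have := mem_contentIdeal x i
  rwa [h, Ideal.mem_bot] at this

lemma bil_mem_contentIdeal_mul (M : Matrix (Fin 3) (Fin 3) (𝓞 F)) (x y : Fin 3 → 𝓞 F) :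
    bil M x y ∈ contentIdeal x * contentIdeal y := by
  refine Ideal.sum_mem _ fun i _ => Ideal.sum_mem _ fun j _ => ?_
  rw [mul_assoc]
  exact Ideal.mul_mem_left _ _ (Ideal.mul_mem_mul (mem_contentIdeal x i) (mem_contentIdeal y j))

/-- Isotropic integral vectors can be sorted into classes indexed by the divisors of the
determinant, such that any triple in a common class has a very divisible determinant. -/
lemma exists_finite_classes {M : Matrix (Fin 3) (Fin 3) (𝓞 F)} (hM : ∀ i j, M i j = M j i)
    (hdet : M.det ≠ 0) (S : Finset (Fin 3 → 𝓞 F)) (hx0 : ∀ x ∈ S, x ≠ 0)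
    (hnull : ∀ x ∈ S, bil M x x = 0) (hne : ∀ x ∈ S, ∀ y ∈ S, x ≠ y → bil M x y ≠ 0) :
    ∃ J : (Fin 3 → 𝓞 F) → Ideal (𝓞 F), (∀ x, J x ∣ Ideal.span {M.det}) ∧
      ∀ x : Fin 3 → Fin 3 → 𝓞 F, (∀ i, x i ∈ S) → (∀ i j, J (x i) = J (x j)) →
        Ideal.span {M.det} ^ 2 *
            (contentIdeal (x 0) * contentIdeal (x 1) * contentIdeal (x 2)) ^ 2 ∣
          Ideal.span {4 * det3 (x 0) (x 1) (x 2) ^ 2} * Ideal.span (minorSet M) ^ 3 := by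
  classical
  by_cases hS : ∃ P ∈ S, ∃ Q ∈ S, P ≠ Q
  swap
  · push Not at hS
    refine ⟨fun _ => 1, fun _ => one_dvd _, fun x hx _ => ?_⟩
    have : det3 (x 0) (x 1) (x 2) = 0 := by
      rw [hS _ (hx 0) _ (hx 1)]
      simp [det3, Matrix.det_fin_three]; ring
    simp [this]
  obtain ⟨P₀, hP₀, Q₀, hQ₀, hPQ₀⟩ := hS
  choose E hE using fun x y => Ideal.dvd_iff_le.2
    ((Ideal.span_singleton_le_iff_mem _).2 (bil_mem_contentIdeal_mul M x y))
  obtain ⟨G, hG⟩ := Ideal.dvd_iff_le.2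
    ((Ideal.span_singleton_le_iff_mem _).2 (det_mem_span_minorSet M))
  have hsdet : Ideal.span {M.det} ≠ ⊥ := Submodule.span_singleton_eq_bot.mp.mt hdet
  have hG0 : G ≠ ⊥ := by rintro rfl; simp at hG; exact hdet hG
  have hm0 : Ideal.span (minorSet M) ≠ ⊥ := by rintro h; rw [h] at hG; simp at hG; exact hdet hG
  have hcpos : ∀ v : HeightOneSpectrum (𝓞 F), ∀ x ∈ S, 0 < idealAbs v (contentIdeal x) :=
    fun v x hx => idealAbs_pos v (contentIdeal_ne_bot (hx0 x hx))
  have hEabs : ∀ v : HeightOneSpectrum (𝓞 F), ∀ x ∈ S, ∀ y ∈ S, finAbs v (bil M x y) /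
      (idealAbs v (contentIdeal x) * idealAbs v (contentIdeal y)) = idealAbs v (E x y) := by
    intro v x hx y hy
    have h1 := hcpos v x hx
    have h2 := hcpos v y hy
    rw [finAbs_eq_idealAbs, hE x y, idealAbs_mul, idealAbs_mul, mul_div_cancel_left₀]
    positivity
  have hmax : ∀ v : HeightOneSpectrum (𝓞 F), ∃ P ∈ S, ∃ Q ∈ S, ∀ x ∈ S, ∀ y ∈ S,
      finAbs v (bil M x y) / (idealAbs v (contentIdeal x) * idealAbs v (contentIdeal y)) ≤
      finAbs v (bil M P Q) / (idealAbs v (contentIdeal P) * idealAbs v (contentIdeal Q)) := by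
    intro v
    obtain ⟨⟨P, Q⟩, hPQS, hmax⟩ := Finset.exists_max_image (S ×ˢ S)
      (fun w => finAbs v (bil M w.1 w.2) /
        (idealAbs v (contentIdeal w.1) * idealAbs v (contentIdeal w.2)))
      ⟨(P₀, Q₀), by simp [hP₀, hQ₀]⟩
    obtain ⟨hPS, hQS⟩ := Finset.mem_product.1 hPQS
    exact ⟨P, hPS, Q, hQS, fun x hx y hy => hmax (x, y) (Finset.mem_product.2 ⟨hx, hy⟩)⟩
  choose P hPS Q hQS hmax using hmax
  have hPQ : ∀ v, bil M (P v) (Q v) ≠ 0 := by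
    intro v h
    have h1 := hmax v P₀ hP₀ Q₀ hQ₀
    rw [h, map_zero, zero_div] at h1
    have h2 := (finAbs v).pos (hne _ hP₀ _ hQ₀ hPQ₀)
    have h3 := hcpos v _ hP₀
    have h4 := hcpos v _ hQ₀
    exact absurd (h1.trans_lt' (div_pos h2 (mul_pos h3 h4))) (lt_irrefl _)
  obtain ⟨J, hJ, hJc⟩ := exists_dvd_of_exponents (D := Ideal.span {M.det})
    (fun x v => idealOrd v (E (P v) x ⊔ G)) (fun x v => by
      refine idealOrd_le_of_dvd v hsdet (Dvd.dvd.trans ?_ (hG ▸ dvd_mul_left _ _))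
      exact Ideal.dvd_iff_le.2 le_sup_right)
  refine ⟨J, hJ, fun x hx hxJ => ?_⟩
  refine dvd_of_idealAbs_le (mul_ne_zero (pow_ne_zero _ hsdet) (pow_ne_zero _
    (mul_ne_zero (mul_ne_zero ?_ ?_) ?_))) fun v => ?_
  · exact contentIdeal_ne_bot (hx0 _ (hx 0))
  · exact contentIdeal_ne_bot (hx0 _ (hx 1))
  · exact contentIdeal_ne_bot (hx0 _ (hx 2))
  have hdne : (minorSet M).Nonempty := ⟨_, 1, 2, 1, 2, by decide, by decide, rfl⟩
  obtain ⟨d, ⟨i₀, i₁, j₀, j₁, hi, hj, hd⟩, hdv⟩ :=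
    exists_mem_finAbs_eq_idealAbs_span v (finite_minorSet M) hdne
  obtain ⟨i, j, hij⟩ := minor_eq_adjugate M hi hj
  have hadj : finAbs v (M.adjugate i j) = idealAbs v (Ideal.span (minorSet M)) := by
    rw [← hdv, hd]
    rcases hij with h | h
    · rw [h]
    · rw [h, (finAbs v).map_neg]
  have hm := idealAbs_pos v hm0
  have hadj0 : M.adjugate i j ≠ 0 := by
    intro h
    rw [h, map_zero] at hadj
    exact hm.ne hadj
  have hε : finAbs v M.det / finAbs v (M.adjugate i j) = idealAbs v G := by
    rw [hadj, finAbs_eq_idealAbs, hG, idealAbs_mul, mul_div_cancel_left₀ _ hm.ne']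
  have habs : ∀ i j, idealAbs v (E (P v) (x i) ⊔ G) = idealAbs v (E (P v) (x j) ⊔ G) := by
    intro i j
    have hne0 : ∀ i, E (P v) (x i) ⊔ G ≠ ⊥ := fun i => ne_bot_of_le_ne_bot hG0 le_sup_right
    have := hJc _ _ (hxJ i j) v
    exact le_antisymm ((idealAbs_le_idealAbs_iff v (hne0 i) (hne0 j)).2 this.ge)
      ((idealAbs_le_idealAbs_iff v (hne0 j) (hne0 i)).2 this.le)
  have hclose : ∀ l m, finAbs v 2 * finAbs v (bil M (x l) (x m)) * finAbs v (M.adjugate i j) ≤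
      finAbs v M.det * (idealAbs v (contentIdeal (x l)) * idealAbs v (contentIdeal (x m))) := by
    intro l m
    refine ultrametric_same_class (isNonarchimedean_finAbs v) hM (hnull _ (hPS v))
      (hnull _ (hQS v)) (hnull _ (hx l)) (hnull _ (hx m))
      (fun i => finAbs_le_of_mem v (mem_contentIdeal _ i))
      (fun i => finAbs_le_of_mem v (mem_contentIdeal _ i))
      (fun i => finAbs_le_of_mem v (mem_contentIdeal _ i))
      (fun i => finAbs_le_of_mem v (mem_contentIdeal _ i))
      (hcpos v _ (hPS v)) (hcpos v _ (hQS v)) (hcpos v _ (hx l)) (hcpos v _ (hx m))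
      (hmax v _ (hPS v) _ (hx l)) (hmax v _ (hQS v) _ (hx l)) (hmax v _ (hPS v) _ (hx m))
      (hmax v _ (hQS v) _ (hx m)) (hPQ v) hadj0 ?_
    rw [hε, hEabs v _ (hPS v) _ (hx l), hEabs v _ (hPS v) _ (hx m), ← idealAbs_sup, ← idealAbs_sup]
    exact habs l m
  have hD := congrArg (finAbs v)
    (det3_sq_mul_det_of_null hM (hnull _ (hx 0)) (hnull _ (hx 1)) (hnull _ (hx 2)))
  simp only [map_mul, map_pow] at hD
  simp only [idealAbs_mul, idealAbs_pow, ← finAbs_eq_idealAbs, map_mul, map_pow]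
  rw [show (4 : 𝓞 F) = 2 ^ 2 by norm_num, map_pow, ← hadj]
  have h01 := hclose 0 1
  have h12 := hclose 1 2
  have h02 := hclose 0 2
  have hδ := (finAbs v).pos hdet
  have p2 := (finAbs v).nonneg 2
  have pa := (finAbs v).nonneg (M.adjugate i j)
  have pB : ∀ l m, 0 ≤ finAbs v (bil M (x l) (x m)) := fun l m => (finAbs v).nonneg _
  have pn : ∀ l, 0 ≤ idealAbs v (contentIdeal (x l)) := fun l => idealAbs_nonneg v _
  have p01 := pB 0 1
  have p12 := pB 1 2
  have p02 := pB 0 2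
  have n0 := pn 0
  have n1 := pn 1
  have n2 := pn 2
  refine le_of_mul_le_mul_left ?_ hδ
  calc finAbs v M.det * (finAbs v 2 ^ 2 * finAbs v (det3 (x 0) (x 1) (x 2)) ^ 2 *
        finAbs v (M.adjugate i j) ^ 3)
      = finAbs v 2 ^ 2 * (finAbs v (det3 (x 0) (x 1) (x 2)) ^ 2 * finAbs v M.det) *
        finAbs v (M.adjugate i j) ^ 3 := by ring
    _ = (finAbs v 2 * finAbs v (bil M (x 0) (x 1)) * finAbs v (M.adjugate i j)) *
        (finAbs v 2 * finAbs v (bil M (x 1) (x 2)) * finAbs v (M.adjugate i j)) *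
        (finAbs v 2 * finAbs v (bil M (x 0) (x 2)) * finAbs v (M.adjugate i j)) := by
        rw [hD]; ring
    _ ≤ (finAbs v M.det * (idealAbs v (contentIdeal (x 0)) * idealAbs v (contentIdeal (x 1)))) *
        (finAbs v M.det * (idealAbs v (contentIdeal (x 1)) * idealAbs v (contentIdeal (x 2)))) *
        (finAbs v M.det * (idealAbs v (contentIdeal (x 0)) * idealAbs v (contentIdeal (x 2)))) := by
        gcongr
    _ = _ := by ring

end FiniteClasses

section HeightBounds

variable {F : Type} [Field F] [NumberField F]

lemma fnorm_algebraMap (v : HeightOneSpectrum (𝓞 F)) (r : 𝓞 F) :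
    fnorm v (algebraMap (𝓞 F) F r) = finAbs v r := by
  have hval : v.valuation F (algebraMap (𝓞 F) F r) = v.intValuation r :=
    v.valuation_of_algebraMap r
  rcases eq_or_ne r 0 with rfl | hr
  · simp [fnorm]
  have h0 : v.intValuation r ≠ 0 := v.intValuation_ne_zero r hr
  rw [fnorm, dif_neg (by rwa [hval])]
  simp only [finAbs, HeightOneSpectrum.intAdicAbv, HeightOneSpectrum.intAdicAbvDef,
    AbsoluteValue.coe_mk, MulHom.coe_mk]
  rw [WithZeroMulInt.toNNReal_neg_apply _ h0]
  simp [hval]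

lemma maxAtFin_algebraMap {ι : Type} [Fintype ι] [Nonempty ι] (v : HeightOneSpectrum (𝓞 F))
    (x : ι → 𝓞 F) :
    maxAtFin v (fun i => algebraMap (𝓞 F) F (x i)) = idealAbs v (contentIdeal x) := by
  simp only [maxAtFin, fnorm_algebraMap]
  apply le_antisymm
  · exact Finset.sup'_le _ _ fun i _ => finAbs_le_of_mem v (mem_contentIdeal x i)
  · obtain ⟨d, ⟨i, rfl⟩, hd⟩ :=
      exists_mem_finAbs_eq_idealAbs_span v (Set.finite_range x) (Set.range_nonempty x)
    rw [contentIdeal, ← hd]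
    exact Finset.le_sup' (fun i => finAbs v (x i)) (Finset.mem_univ i)

lemma idealAbs_le_one (v : HeightOneSpectrum (𝓞 F)) (I : Ideal (𝓞 F)) : idealAbs v I ≤ 1 := by
  have h := idealAbs_le_of_le v (le_top (a := I))
  have h1 := idealAbs_pow v (⊤ : Ideal (𝓞 F)) 0
  rw [pow_zero, pow_zero, Ideal.one_eq_top] at h1
  rwa [h1] at h

/-- The factor of the standard height at a finite place is bounded below in terms of ideals. -/
lemma idealAbs_le_local_height (v : HeightOneSpectrum (𝓞 F)) {I : Ideal (𝓞 F)} (hI : I ≠ ⊥)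
    (x : Fin 3 → 𝓞 F) (A : ℝ) (a : Fin 3 → ℤ) {E : ℕ} (hE : ∀ j, A + a j ≤ E) :
    idealAbs v (I ^ E * contentIdeal x) ≤ idealAbs v I ^ A *
      Finset.univ.sup' Finset.univ_nonempty
        (fun j => idealAbs v I ^ ((a j : ℤ) : ℝ) * finAbs v (x j)) := by
  obtain ⟨d, ⟨i, rfl⟩, hd⟩ :=
    exists_mem_finAbs_eq_idealAbs_span v (Set.finite_range x) (Set.range_nonempty x)
  have hp := idealAbs_pos v hI
  rw [idealAbs_mul, idealAbs_pow, contentIdeal, ← hd]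
  calc idealAbs v I ^ E * finAbs v (x i)
      ≤ idealAbs v I ^ (A + a i) * finAbs v (x i) := by
        gcongr
        rw [← Real.rpow_natCast]
        exact Real.rpow_le_rpow_of_exponent_ge hp (idealAbs_le_one v I) (hE i)
    _ = idealAbs v I ^ A * (idealAbs v I ^ ((a i : ℤ) : ℝ) * finAbs v (x i)) := by
        rw [Real.rpow_add hp]; ring
    _ ≤ _ := by
        gcongr
        exact Finset.le_sup' (fun j => idealAbs v I ^ ((a j : ℤ) : ℝ) * finAbs v (x j))
          (Finset.mem_univ i)

lemma inv_absNorm_le_finprod {I : Ideal (𝓞 F)} (hI : I ≠ ⊥)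
    {x : Fin 3 → 𝓞 F} (hx : x ≠ 0) (A : ℝ) (a : Fin 3 → ℤ) {E : ℕ} (hE : ∀ j, A + a j ≤ E) :
    ((Ideal.absNorm I : ℝ) ^ E * Ideal.absNorm (contentIdeal x))⁻¹ ≤
      ∏ᶠ v : HeightOneSpectrum (𝓞 F), (idealAbs v I ^ A *
        Finset.univ.sup' Finset.univ_nonempty
          (fun j => idealAbs v I ^ ((a j : ℤ) : ℝ) * finAbs v (x j))) := by
  have hc := contentIdeal_ne_bot hx
  have hIc : I ^ E * contentIdeal x ≠ ⊥ := mul_ne_zero (pow_ne_zero _ hI) hc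
  have h1 := finprod_idealAbs hIc
  rw [map_mul, map_pow] at h1
  push_cast at h1
  rw [← h1]
  have hs1 := hasFiniteMulSupport_idealAbs hI
  have hs2 := hasFiniteMulSupport_idealAbs hc
  have hs3 := hasFiniteMulSupport_idealAbs hIc
  have hs : (Function.mulSupport fun v : HeightOneSpectrum (𝓞 F) => (idealAbs v I ^ A *
        Finset.univ.sup' Finset.univ_nonempty
          (fun j => idealAbs v I ^ ((a j : ℤ) : ℝ) * finAbs v (x j)))).Finite := by
    refine (hs1.union hs2).subset fun v hv => ?_
    by_contra hcon
    simp only [Set.mem_union, Function.mem_mulSupport, not_or, not_not] at hcon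
    apply hv
    have := maxAtFin_algebraMap v x
    simp only [maxAtFin, fnorm_algebraMap] at this
    simp only [hcon.1, Real.one_rpow, one_mul]
    rw [this, hcon.2]
  classical
  rw [finprod_eq_prod_of_mulSupport_subset (s := hs.toFinset ∪ hs3.toFinset) _
      (by rw [Finset.coe_union, hs3.coe_toFinset]; exact Set.subset_union_right),
    finprod_eq_prod_of_mulSupport_subset (s := hs.toFinset ∪ hs3.toFinset) _
      (by rw [Finset.coe_union, hs.coe_toFinset]; exact Set.subset_union_left)]
  exact Finset.prod_le_prod (fun v _ => idealAbs_nonneg v _)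
    fun v _ => idealAbs_le_local_height v hI x A a hE

/-- The twisted sup norm of a vector at an infinite place. -/
def twistedNorm (a : Fin 3 → ℤ) {m : ℕ} (z : Fin (m + 1) → 𝓞 F) (w : InfinitePlace F)
    (x : Fin 3 → 𝓞 F) : ℝ :=
  Finset.univ.sup' Finset.univ_nonempty fun j =>
    maxAt w (fun i => algebraMap (𝓞 F) F (z i)) ^ ((a j : ℤ) : ℝ) * w (algebraMap (𝓞 F) F (x j))

lemma maxAt_nonneg {ι : Type} [Fintype ι] [Nonempty ι] (w : InfinitePlace F) (x : ι → F) :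
    0 ≤ maxAt w x :=
  (apply_nonneg w _).trans
    (Finset.le_sup' (fun i => w (x i)) (Finset.mem_univ (Classical.arbitrary ι)))

lemma maxAt_pos {ι : Type} [Fintype ι] [Nonempty ι] (w : InfinitePlace F) {x : ι → 𝓞 F}
    (hx : x ≠ 0) : 0 < maxAt w (fun i => algebraMap (𝓞 F) F (x i)) := by
  obtain ⟨i, hi⟩ := Function.ne_iff.1 hx
  refine lt_of_lt_of_le ?_ (Finset.le_sup' (fun i => w (algebraMap (𝓞 F) F (x i)))
    (Finset.mem_univ i))
  exact InfinitePlace.pos_iff.2 (by simpa using hi)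

lemma le_twistedNorm (a : Fin 3 → ℤ) {m : ℕ} (z : Fin (m + 1) → 𝓞 F) (w : InfinitePlace F)
    (x : Fin 3 → 𝓞 F) (j : Fin 3) :
    maxAt w (fun i => algebraMap (𝓞 F) F (z i)) ^ ((a j : ℤ) : ℝ) * w (algebraMap (𝓞 F) F (x j)) ≤
      twistedNorm a z w x :=
  Finset.le_sup' (fun j => maxAt w (fun i => algebraMap (𝓞 F) F (z i)) ^ ((a j : ℤ) : ℝ) *
    w (algebraMap (𝓞 F) F (x j))) (Finset.mem_univ j)

lemma twistedNorm_pos (a : Fin 3 → ℤ) {m : ℕ} {z : Fin (m + 1) → 𝓞 F} (hz : z ≠ 0)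
    (w : InfinitePlace F) {x : Fin 3 → 𝓞 F} (hx : x ≠ 0) : 0 < twistedNorm a z w x := by
  obtain ⟨j, hj⟩ := Function.ne_iff.1 hx
  refine lt_of_lt_of_le ?_ (le_twistedNorm a z w x j)
  have := maxAt_pos w hz
  have : 0 < w (algebraMap (𝓞 F) F (x j)) := InfinitePlace.pos_iff.2 (by simpa using hj)
  positivity

lemma Hinf_pos {m : ℕ} {z : Fin (m + 1) → 𝓞 F} (hz : z ≠ 0) : 0 < Hinf z :=
  Finset.prod_pos fun w _ => pow_pos (maxAt_pos w hz) _

lemma prod_maxAt_rpow {m : ℕ} (z : Fin (m + 1) → 𝓞 F) (t : ℝ) :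
    ∏ w : InfinitePlace F, (maxAt w (fun i => algebraMap (𝓞 F) F (z i)) ^ t) ^ w.mult =
      Hinf z ^ t := by
  rw [Hinf, ← Real.finsetProd_rpow _ _ fun w _ => pow_nonneg (maxAt_nonneg w _) _]
  refine Finset.prod_congr rfl fun w _ => ?_
  rw [← Real.rpow_natCast, ← Real.rpow_natCast, ← Real.rpow_mul (maxAt_nonneg w _),
    ← Real.rpow_mul (maxAt_nonneg w _), mul_comm]

/-- A lower bound for the standard height of an integral representative. -/
lemma le_Hstd {m : ℕ} (a : Fin 3 → ℤ) (e : ℤ) (α : ℚ)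
    (f : Fin 3 → Fin 3 → MvPolynomial (Fin (m + 1)) (𝓞 F)) (P : PtRep F m f)
    {z : Fin (m + 1) → 𝓞 F} (hz : z ≠ 0) {x : Fin 3 → 𝓞 F}
    (hy : ∀ i, P.y i = algebraMap (𝓞 F) F (z i)) (hx : ∀ j, P.x j = algebraMap (𝓞 F) F (x j))
    {E : ℕ} (hE : ∀ j, Aexp m a e α + a j ≤ E) :
    Hinf z ^ Aexp m a e α * (∏ w : InfinitePlace F, twistedNorm a z w x ^ w.mult) *
      ((Ideal.absNorm (contentIdeal z) : ℝ) ^ E * Ideal.absNorm (contentIdeal x))⁻¹ ≤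
      Hstd a e α f P := by
  have hx0 : x ≠ 0 := by
    rintro rfl
    exact P.hx (funext fun j => by simp [hx])
  have hy' : P.y = fun i => algebraMap (𝓞 F) F (z i) := funext hy
  have hx' : P.x = fun i => algebraMap (𝓞 F) F (x i) := funext hx
  rw [Hstd, hy', hx', ← prod_maxAt_rpow, ← Finset.prod_mul_distrib]
  simp only [maxAtFin_algebraMap, fnorm_algebraMap, ← mul_pow]
  refine mul_le_mul_of_nonneg_left
    (inv_absNorm_le_finprod (contentIdeal_ne_bot hz) hx0 _ a hE) ?_
  refine Finset.prod_nonneg fun w _ => pow_nonneg (mul_nonneg ?_ (twistedNorm_pos a hz w hx0).le) _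
  exact Real.rpow_nonneg (maxAt_nonneg w _) _

end HeightBounds

section Counting

variable {F : Type} [Field F] [NumberField F]

lemma absNorm_span_pos {r : 𝓞 F} (hr : r ≠ 0) : 0 < Ideal.absNorm (Ideal.span {r}) := by
  rw [Nat.pos_iff_ne_zero, Ne, Ideal.absNorm_eq_zero_iff]
  exact Submodule.span_singleton_eq_bot.mp.mt hr

lemma absNorm_le_of_span_dvd {D δ : 𝓞 F} (hD : D ≠ 0) {I J : Ideal (𝓞 F)} (hJ : J ≠ ⊥)
    (h : Ideal.span {δ} ^ 2 * I ^ 2 ∣ Ideal.span {4 * D ^ 2} * J ^ 3) :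
    (Ideal.absNorm (Ideal.span {δ}) : ℝ) ^ 2 * (Ideal.absNorm I : ℝ) ^ 2 ≤
      Ideal.absNorm (Ideal.span {(4 : 𝓞 F)}) * (Ideal.absNorm (Ideal.span {D}) : ℝ) ^ 2 *
        (Ideal.absNorm J : ℝ) ^ 3 := by
  have h4 : Ideal.span {4 * D ^ 2} = Ideal.span {(4 : 𝓞 F)} * Ideal.span {D} ^ 2 := by
    rw [Ideal.span_singleton_pow, Ideal.span_singleton_mul_span_singleton]
  have h1 := map_dvd (Ideal.absNorm (S := 𝓞 F)) h
  rw [h4] at h1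
  simp only [map_mul, map_pow] at h1
  have p4 : 0 < Ideal.absNorm (Ideal.span {(4 : 𝓞 F)}) := absNorm_span_pos (by norm_num)
  have pD := absNorm_span_pos hD
  have pJ : 0 < Ideal.absNorm J := by
    rw [Nat.pos_iff_ne_zero, Ne, Ideal.absNorm_eq_zero_iff]; exact hJ
  have h2 := Nat.le_of_dvd (by positivity) h1
  exact_mod_cast h2

lemma absNorm_span_eq_prod (D : 𝓞 F) :
    (Ideal.absNorm (Ideal.span {D}) : ℝ) =
      ∏ w : InfinitePlace F, w (algebraMap (𝓞 F) F D) ^ w.mult := by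
  rw [InfinitePlace.prod_eq_abs_norm, Ideal.absNorm_span_singleton, Nat.cast_natAbs]
  rw [show (algebraMap (𝓞 F) F D) = ((D : 𝓞 F) : F) from rfl, ← Algebra.coe_norm_int]
  push_cast
  rfl

/-- Hadamard's inequality for the twisted norms. -/
lemma det3_mul_rpow_le (a : Fin 3 → ℤ) {m : ℕ} {z : Fin (m + 1) → 𝓞 F} (hz : z ≠ 0)
    (w : InfinitePlace F) (x y t : Fin 3 → 𝓞 F) :
    w (algebraMap (𝓞 F) F (det3 x y t)) *
        maxAt w (fun i => algebraMap (𝓞 F) F (z i)) ^ ((a 0 : ℝ) + a 1 + a 2) ≤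
      6 * (twistedNorm a z w x * twistedNorm a z w y * twistedNorm a z w t) := by
  set Y := maxAt w (fun i => algebraMap (𝓞 F) F (z i)) with hY
  have hYp : 0 < Y := maxAt_pos w hz
  set ν : 𝓞 F → ℝ := fun r => w (algebraMap (𝓞 F) F r) with hν
  have hν0 : ∀ r, 0 ≤ ν r := fun r => apply_nonneg w _
  have hmul : ∀ r s, ν (r * s) = ν r * ν s := fun r s => by simp [hν]
  have hadd : ∀ r s, ν (r + s) ≤ ν r + ν s := fun r s => by
    simp only [hν, map_add]; exact w.1.add_le _ _
  have hsub : ∀ r s, ν (r - s) ≤ ν r + ν s := fun r s => by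
    simp only [hν, map_sub]
    have := w.1.add_le (algebraMap (𝓞 F) F r) (-algebraMap (𝓞 F) F s)
    rw [AbsoluteValue.map_neg, ← sub_eq_add_neg] at this
    exact this
  have hb : ∀ (v : Fin 3 → 𝓞 F) (j : Fin 3), Y ^ (a j : ℝ) * ν (v j) ≤ twistedNorm a z w v :=
    fun v j => le_twistedNorm a z w v j
  have hn : ∀ v : Fin 3 → 𝓞 F, 0 ≤ twistedNorm a z w v := fun v =>
    le_trans (by have := hν0 (v 0); positivity) (hb v 0)
  have hterm : ∀ p q r : Fin 3, Y ^ ((a p : ℝ) + a q + a r) * (ν (x p) * ν (y q) * ν (t r)) ≤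
      twistedNorm a z w x * twistedNorm a z w y * twistedNorm a z w t := by
    intro p q r
    rw [Real.rpow_add hYp, Real.rpow_add hYp]
    calc _ = (Y ^ (a p : ℝ) * ν (x p)) * (Y ^ (a q : ℝ) * ν (y q)) *
          (Y ^ (a r : ℝ) * ν (t r)) := by ring
      _ ≤ _ := by
        have h1 := hν0 (x p)
        have h2 := hν0 (y q)
        have h3 := hν0 (t r)
        have := hn x
        have := hn y
        exact mul_le_mul (mul_le_mul (hb x p) (hb y q) (by positivity) (hn x)) (hb t r)
          (by positivity) (by positivity)
  have hdet : ν (det3 x y t) ≤ ν (x 0) * ν (y 1) * ν (t 2) + ν (x 0) * ν (y 2) * ν (t 1) +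
      ν (x 1) * ν (y 0) * ν (t 2) + ν (x 1) * ν (y 2) * ν (t 0) +
      ν (x 2) * ν (y 0) * ν (t 1) + ν (x 2) * ν (y 1) * ν (t 0) := by
    have e : det3 x y t = x 0 * y 1 * t 2 - x 0 * y 2 * t 1 - x 1 * y 0 * t 2 +
        x 1 * y 2 * t 0 + x 2 * y 0 * t 1 - x 2 * y 1 * t 0 := by
      simp [det3, Matrix.det_fin_three]
    rw [e]
    simp only [← hmul]
    refine (hsub _ _).trans (add_le_add_left ?_ _)
    refine (hadd _ _).trans (add_le_add_left ?_ _)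
    refine (hadd _ _).trans (add_le_add_left ?_ _)
    refine (hsub _ _).trans (add_le_add_left ?_ _)
    exact hsub _ _
  have hYs : 0 ≤ Y ^ ((a 0 : ℝ) + a 1 + a 2) := by positivity
  have h012 := hterm 0 1 2
  have h021 := hterm 0 2 1
  have h102 := hterm 1 0 2
  have h120 := hterm 1 2 0
  have h201 := hterm 2 0 1
  have h210 := hterm 2 1 0
  rw [show (a 0 : ℝ) + a 2 + a 1 = a 0 + a 1 + a 2 by ring] at h021
  rw [show (a 1 : ℝ) + a 0 + a 2 = a 0 + a 1 + a 2 by ring] at h102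
  rw [show (a 1 : ℝ) + a 2 + a 0 = a 0 + a 1 + a 2 by ring] at h120
  rw [show (a 2 : ℝ) + a 0 + a 1 = a 0 + a 1 + a 2 by ring] at h201
  rw [show (a 2 : ℝ) + a 1 + a 0 = a 0 + a 1 + a 2 by ring] at h210
  have := mul_le_mul_of_nonneg_right hdet hYs
  change ν (det3 x y t) * _ ≤ _
  linarith

end Counting

section Pigeonhole

variable {F : Type} [Field F] [NumberField F]

lemma det3_ne_zero_of_bil_ne_zero {M : Matrix (Fin 3) (Fin 3) (𝓞 F)} (hM : ∀ i j, M i j = M j i)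
    {x y t : Fin 3 → 𝓞 F} (hx : bil M x x = 0) (hy : bil M y y = 0) (ht : bil M t t = 0)
    (hxy : bil M x y ≠ 0) (hyt : bil M y t ≠ 0) (hxt : bil M x t ≠ 0) : det3 x y t ≠ 0 := by
  intro h
  have := det3_sq_mul_det_of_null hM hx hy ht
  rw [h] at this
  have h2 : (2 : 𝓞 F) * bil M x y * bil M y t * bil M x t ≠ 0 := by
    have : (2 : 𝓞 F) ≠ 0 := by norm_num
    positivity
  apply h2
  rw [← this]
  ring

/-- The norm of the determinant of three vectors that are close at one place. -/
lemma absNorm_det3_mul_le (a : Fin 3 → ℤ) {m : ℕ} {z : Fin (m + 1) → 𝓞 F} (hz : z ≠ 0)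
    (w₀ : InfinitePlace F) {L : ℝ} (hL : 0 < L) {x : Fin 3 → Fin 3 → 𝓞 F} (hx : ∀ i, x i ≠ 0)
    (hclose : w₀ (algebraMap (𝓞 F) F (det3 (x 0) (x 1) (x 2))) *
        maxAt w₀ (fun i => algebraMap (𝓞 F) F (z i)) ^ ((a 0 : ℝ) + a 1 + a 2) * L ^ 3 ≤
      384 * (twistedNorm a z w₀ (x 0) * twistedNorm a z w₀ (x 1) * twistedNorm a z w₀ (x 2))) :
    (Ideal.absNorm (Ideal.span {det3 (x 0) (x 1) (x 2)}) : ℝ) *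
        Hinf z ^ ((a 0 : ℝ) + a 1 + a 2) * (L ^ 3) ^ w₀.mult ≤
      (∏ w : InfinitePlace F, (384 : ℝ) ^ w.mult) *
        ((∏ w : InfinitePlace F, twistedNorm a z w (x 0) ^ w.mult) *
          (∏ w : InfinitePlace F, twistedNorm a z w (x 1) ^ w.mult) *
          ∏ w : InfinitePlace F, twistedNorm a z w (x 2) ^ w.mult) := by
  classical
  have hL' : (L ^ 3) ^ w₀.mult =
      ∏ w : InfinitePlace F, (if w = w₀ then L ^ 3 else 1) ^ w.mult := by
    rw [Finset.prod_eq_single w₀]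
    · simp
    · intro w _ hw; simp [hw]
    · simp
  rw [absNorm_span_eq_prod, ← prod_maxAt_rpow, hL', ← Finset.prod_mul_distrib,
    ← Finset.prod_mul_distrib, ← Finset.prod_mul_distrib, ← Finset.prod_mul_distrib,
    ← Finset.prod_mul_distrib]
  simp only [← mul_pow]
  have hY : ∀ w : InfinitePlace F, 0 ≤ maxAt w (fun i => algebraMap (𝓞 F) F (z i)) ^
      ((a 0 : ℝ) + a 1 + a 2) := fun w => Real.rpow_nonneg (maxAt_nonneg w _) _
  refine Finset.prod_le_prod (fun w _ => pow_nonneg (mul_nonneg (mul_nonneg (apply_nonneg w _)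
    (hY w)) (by split_ifs <;> positivity)) _) fun w _ => pow_le_pow_left₀
    (mul_nonneg (mul_nonneg (apply_nonneg w _) (hY w)) (by split_ifs <;> positivity)) ?_ _
  split_ifs with h
  · rw [h]; exact hclose
  · rw [mul_one]
    refine (det3_mul_rpow_le a hz w _ _ _).trans ?_
    have h0 := twistedNorm_pos a hz w (hx 0)
    have h1 := twistedNorm_pos a hz w (hx 1)
    have h2 := twistedNorm_pos a hz w (hx 2)
    gcongr
    norm_num

lemma finite_dvd_span {r : 𝓞 F} (hr : r ≠ 0) : {J : Ideal (𝓞 F) | J ∣ Ideal.span {r}}.Finite := by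
  classical
  have h0 : Ideal.span {r} ≠ 0 := Submodule.span_singleton_eq_bot.mp.mt hr
  have := UniqueFactorizationMonoid.fintypeSubtypeDvd (Ideal.span {r}) h0
  exact @Finite.of_fintype {J : Ideal (𝓞 F) // J ∣ Ideal.span {r}} this

/-- Counting isotropic vectors by sorting them into classes with at most two elements. -/
lemma card_isotropic_le {M : Matrix (Fin 3) (Fin 3) (𝓞 F)} (hM : ∀ i j, M i j = M j i)
    (hdet : M.det ≠ 0) (S : Finset (Fin 3 → 𝓞 F)) (hx0 : ∀ x ∈ S, x ≠ 0)
    (hnull : ∀ x ∈ S, bil M x x = 0) (hne : ∀ x ∈ S, ∀ y ∈ S, x ≠ y → bil M x y ≠ 0)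
    (a : Fin 3 → ℤ) {m : ℕ} {z : Fin (m + 1) → 𝓞 F} (hz : z ≠ 0) {R : ℝ}
    (hT : ∀ x ∈ S, ∏ w : InfinitePlace F, twistedNorm a z w x ^ w.mult ≤
      R * Ideal.absNorm (contentIdeal x))
    (w₀ : InfinitePlace F) {L : ℕ} (hL : 1 ≤ L)
    (hbig : Ideal.absNorm (Ideal.span {(4 : 𝓞 F)}) * (Ideal.absNorm (Ideal.span (minorSet M)) : ℝ) ^ 3
        * ((∏ w : InfinitePlace F, (384 : ℝ) ^ w.mult) * R ^ 3) ^ 2 <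
      (Ideal.absNorm (Ideal.span {M.det}) * Hinf z ^ ((a 0 : ℝ) + a 1 + a 2) *
        ((L : ℝ) ^ w₀.mult) ^ 3) ^ 2) :
    S.card ≤ 36 * tauk M.det * L ^ w₀.mult := by
  classical
  obtain ⟨J, hJ, hJdvd⟩ := exists_finite_classes hM hdet S hx0 hnull hne
  set Y := maxAt w₀ (fun i => algebraMap (𝓞 F) F (z i)) ^ ((a 0 : ℝ) + a 1 + a 2) with hYdef
  have hY : 0 < Y := Real.rpow_pos_of_pos (maxAt_pos w₀ hz) _
  set σ : 𝓞 F →+* ℂ := w₀.embedding.comp (algebraMap (𝓞 F) F) with hσdef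
  have hσ : ∀ r, ‖σ r‖ = w₀ (algebraMap (𝓞 F) F r) := fun r => by
    rw [hσdef, RingHom.comp_apply, InfinitePlace.norm_embedding_eq]
  have hσinj : Function.Injective σ :=
    w₀.embedding.injective.comp (FaithfulSMul.algebraMap_injective (𝓞 F) F)
  have hmult : w₀.mult = 2 ∨ w₀.mult = 1 ∧ ∀ r, (σ r).im = 0 := by
    by_cases hw : w₀.IsReal
    · right
      refine ⟨hw.mult_eq_one, fun r => ?_⟩
      rw [hσdef, RingHom.comp_apply, ← InfinitePlace.embedding_of_isReal_apply hw,
        Complex.ofReal_im]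
    · left
      rw [InfinitePlace.mult, if_neg hw]
  obtain ⟨cl, T, hTcard, hclT, hcl⟩ := exists_archimedean_classes σ hσinj hM hdet S hnull hne
    (twistedNorm a z w₀) (fun x hx => twistedNorm_pos a hz w₀ (hx0 x hx))
    (K := 6 / Y) (by positivity)
    (fun x _ y _ t _ => by
      rw [hσ, div_mul_eq_mul_div, le_div_iff₀ hY]
      exact det3_mul_rpow_le a hz w₀ x y t) hmult hL
  have hfin := finite_dvd_span hdet
  have htau : tauk M.det = hfin.toFinset.card := by
    rw [tauk, ← Set.ncard_eq_toFinset_card _ hfin]; rfl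
  by_contra! hcon
  have hmaps : ∀ x ∈ S, (J x, cl x) ∈ hfin.toFinset ×ˢ T := fun x hx =>
    Finset.mem_product.2 ⟨hfin.mem_toFinset.2 (hJ x), hclT x hx⟩
  obtain ⟨c, -, hc⟩ := Finset.exists_lt_card_fiber_of_mul_lt_card_of_maps_to (n := 2) hmaps (by
    rw [Finset.card_product, ← htau]
    refine lt_of_le_of_lt ?_ hcon
    calc tauk M.det * T.card * 2 ≤ tauk M.det * (18 * L ^ w₀.mult) * 2 := by gcongr
      _ = _ := by ring)
  obtain ⟨p, q, r, hp, hq, hr, hpq, hpr, hqr⟩ := Finset.two_lt_card_iff.1 hc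
  rw [Finset.mem_filter] at hp hq hr
  set x : Fin 3 → Fin 3 → 𝓞 F := ![p, q, r] with hxdef
  have hxS : ∀ i, x i ∈ S := by
    intro i; fin_cases i
    exacts [hp.1, hq.1, hr.1]
  have hxc : ∀ i, (J (x i), cl (x i)) = c := by
    intro i; fin_cases i
    exacts [hp.2, hq.2, hr.2]
  have hD0 : det3 (x 0) (x 1) (x 2) ≠ 0 :=
    det3_ne_zero_of_bil_ne_zero hM (hnull p hp.1) (hnull q hq.1) (hnull r hr.1)
      (hne p hp.1 q hq.1 hpq) (hne q hq.1 r hr.1 hqr) (hne p hp.1 r hr.1 hpr)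
  have hm0 : Ideal.span (minorSet M) ≠ ⊥ := by
    intro h
    have := det_mem_span_minorSet M
    rw [h, Ideal.mem_bot] at this
    exact hdet this
  have hfinite := absNorm_le_of_span_dvd hD0 hm0 (hJdvd x hxS fun i j => by
    have := (hxc i).trans (hxc j).symm
    exact congrArg Prod.fst this)
  have hL0 : (0 : ℝ) < L := by exact_mod_cast hL
  have hclose := hcl x hxS fun i j => congrArg Prod.snd ((hxc i).trans (hxc j).symm)
  have hnorm := absNorm_det3_mul_le a hz w₀ hL0 (fun i => hx0 _ (hxS i)) (by
    rw [hσ] at hclose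
    rw [← hYdef]
    calc _ ≤ 64 * (6 / Y) / (L : ℝ) ^ 3 * (twistedNorm a z w₀ (x 0) * twistedNorm a z w₀ (x 1) *
          twistedNorm a z w₀ (x 2)) * Y * (L : ℝ) ^ 3 := by gcongr
      _ = _ := by field_simp; ring)
  have hTpos : ∀ i, 0 ≤ ∏ w : InfinitePlace F, twistedNorm a z w (x i) ^ w.mult := fun i =>
    Finset.prod_nonneg fun w _ => pow_nonneg (twistedNorm_pos a hz w (hx0 _ (hxS i))).le _
  have hH := Real.rpow_pos_of_pos (Hinf_pos hz) ((a 0 : ℝ) + a 1 + a 2)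
  have hNc : ∀ i, 0 < (Ideal.absNorm (contentIdeal (x i)) : ℝ) := fun i => by
    rw [Nat.cast_pos, Nat.pos_iff_ne_zero, Ne, Ideal.absNorm_eq_zero_iff]
    exact contentIdeal_ne_bot (hx0 _ (hxS i))
  rw [map_mul, map_mul] at hfinite
  push_cast at hfinite
  rw [pow_right_comm] at hnorm
  have hTle : ∀ i, _ := fun i => hT _ (hxS i)
  have hTprod := mul_le_mul (mul_le_mul (hTle 0) (hTle 1) (hTpos 1) ((hTpos 0).trans (hTle 0)))
    (hTle 2) (hTpos 2)
    (mul_nonneg ((hTpos 0).trans (hTle 0)) ((hTpos 1).trans (hTle 1)))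
  set n₀ := (Ideal.absNorm (contentIdeal (x 0)) : ℝ)
  set n₁ := (Ideal.absNorm (contentIdeal (x 1)) : ℝ)
  set n₂ := (Ideal.absNorm (contentIdeal (x 2)) : ℝ)
  have hc : 0 < n₀ * n₁ * n₂ := mul_pos (mul_pos (hNc 0) (hNc 1)) (hNc 2)
  set G := ∏ w : InfinitePlace F, (384 : ℝ) ^ w.mult with hGdef
  have hG : 0 ≤ G := Finset.prod_nonneg fun w _ => by positivity
  have h1 := hnorm.trans (mul_le_mul_of_nonneg_left hTprod hG)
  have h2 := pow_le_pow_left₀ (by positivity) h1 2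
  refine absurd hbig (not_lt.2 (le_of_mul_le_mul_right ?_ (pow_pos hc 2)))
  have h3 := mul_le_mul_of_nonneg_left h2 (a := (Ideal.absNorm (Ideal.span {(4 : 𝓞 F)}) : ℝ) *
    (Ideal.absNorm (Ideal.span (minorSet M)) : ℝ) ^ 3) (by positivity)
  have h4 := mul_le_mul_of_nonneg_left hfinite (a := (Hinf z ^ ((a 0 : ℝ) + a 1 + a 2) *
    ((L : ℝ) ^ w₀.mult) ^ 3) ^ 2) (by positivity)
  linarith

end Pigeonhole

section Fibres

variable {F : Type} [Field F] [NumberField F] {m : ℕ}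

lemma ptRel_of_smul (a : Fin 3 → ℤ) {f : Fin 3 → Fin 3 → MvPolynomial (Fin (m + 1)) (𝓞 F)}
    {P P' : PtRep F m f} (hy : P'.y = P.y) {c : F} (hc : c ≠ 0) (hx : ∀ j, P'.x j = c * P.x j) :
    ptRel a f P P' :=
  ⟨1, Units.mk0 c hc, fun i => by simp [hy], fun j => by simp [hx]⟩

lemma ptRel_of_proportional (a : Fin 3 → ℤ)
    {f : Fin 3 → Fin 3 → MvPolynomial (Fin (m + 1)) (𝓞 F)} {P P' : PtRep F m f} (hy : P'.y = P.y)
    (h : ∀ i j, P.x i * P'.x j = P.x j * P'.x i) : ptRel a f P P' := by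
  obtain ⟨j, hj⟩ := Function.ne_iff.1 P.hx
  have hj' : P.x j ≠ 0 := hj
  have hx : ∀ i, P'.x i = P'.x j / P.x j * P.x i := fun i => by
    field_simp
    linear_combination h j i
  refine ptRel_of_smul a hy (c := P'.x j / P.x j) (fun hc => P'.hx (funext fun i => ?_)) hx
  rw [hx i, hc, zero_mul]; rfl

/-- Every point has a representative with integral fibre coordinates. -/
lemma exists_integral_rep (a : Fin 3 → ℤ)
    {f : Fin 3 → Fin 3 → MvPolynomial (Fin (m + 1)) (𝓞 F)} (P : PtRep F m f) :
    ∃ (x : Fin 3 → 𝓞 F) (P' : PtRep F m f), P'.y = P.y ∧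
      (∀ j, P'.x j = algebraMap (𝓞 F) F (x j)) ∧ ptRel a f P P' := by
  obtain ⟨b, hb⟩ := IsLocalization.exist_integer_multiples_of_finite
    (nonZeroDivisors (𝓞 F)) P.x
  choose x hx using hb
  have hb0 : algebraMap (𝓞 F) F b ≠ 0 := by
    simp
  have hx' : ∀ j, algebraMap (𝓞 F) F b * P.x j = algebraMap (𝓞 F) F (x j) := fun j => by
    rw [hx j, Algebra.smul_def]
  refine ⟨x, ⟨P.y, fun j => algebraMap (𝓞 F) F b * P.x j, P.hy, fun h => P.hx (funext fun j => ?_),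
    ?_⟩, rfl, hx', ptRel_of_smul a rfl hb0 fun _ => rfl⟩
  · exact (mul_eq_zero.1 (congrFun h j)).resolve_left hb0
  · calc _ = algebraMap (𝓞 F) F b ^ 2 *
          ∑ i : Fin 3, ∑ j : Fin 3, aeval P.y (f i j) * P.x i * P.x j := by
          simp only [Finset.mul_sum]
          exact Finset.sum_congr rfl fun i _ => Finset.sum_congr rfl fun j _ => by ring
      _ = 0 := by rw [P.hQ, mul_zero]

lemma bil_self_eq_zero {f : Fin 3 → Fin 3 → MvPolynomial (Fin (m + 1)) (𝓞 F)} (P : PtRep F m f)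
    {z : Fin (m + 1) → 𝓞 F} {x : Fin 3 → 𝓞 F}
    (hy : ∀ i, P.y i = algebraMap (𝓞 F) F (z i)) (hx : ∀ j, P.x j = algebraMap (𝓞 F) F (x j)) :
    bil (Matrix.of fun i j => eval z (f i j)) x x = 0 := by
  apply FaithfulSMul.algebraMap_injective (𝓞 F) F
  have hy' : P.y = algebraMap (𝓞 F) F ∘ z := funext hy
  have h := P.hQ
  simp only [hy', aeval_algebraMap_apply, hx] at h
  rw [map_zero, ← h, bil]
  simp

/-- The points of bounded height on a nondegenerate conic fibre, counted by their heights. -/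
lemma ncountFib_le (a : Fin 3 → ℤ) {e : ℤ} {α : ℚ}
    {f : Fin 3 → Fin 3 → MvPolynomial (Fin (m + 1)) (𝓞 F)} (hf : ∀ i j, f i j = f j i)
    {H : PtRep F m f → ℝ} (hHinv : ∀ P P', ptRel a f P P' → H P = H P') {c : ℝ} (hc : 0 < c)
    (hH : ∀ P, c * Hstd a e α f P ≤ H P) {z : Fin (m + 1) → 𝓞 F} (hz : z ≠ 0)
    (hΔ : DeltaO f z ≠ 0) {E : ℕ} (hE : ∀ j, Aexp m a e α + a j ≤ E) (B : ℝ)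
    (w₀ : InfinitePlace F) {L : ℕ} (hL : 1 ≤ L)
    (hbig : Ideal.absNorm (Ideal.span {(4 : 𝓞 F)}) * (Ideal.absNorm (minorsIdeal f z) : ℝ) ^ 3
        * ((∏ w : InfinitePlace F, (384 : ℝ) ^ w.mult) *
          (B * (Ideal.absNorm (contentIdeal z) : ℝ) ^ E / (c * Hinf z ^ Aexp m a e α)) ^ 3) ^ 2 <
      (Ideal.absNorm (Ideal.span {DeltaO f z}) * Hinf z ^ ((a 0 : ℝ) + a 1 + a 2) *
        ((L : ℝ) ^ w₀.mult) ^ 3) ^ 2) :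
    NcountFib a f z H B ≤ 36 * tauk (DeltaO f z) * L ^ w₀.mult := by
  classical
  rw [NcountFib]
  set Q := {q : Quot (ptRel a f) // ∃ P : PtRep F m f,
    (∀ i, P.y i = algebraMap (𝓞 F) F (z i)) ∧ H P ≤ B ∧ Quot.mk (ptRel a f) P = q}
  rcases finite_or_infinite Q with hQ | hQ
  swap
  · rw [Nat.card_eq_zero_of_infinite]; exact Nat.zero_le _
  have hrep : ∀ q : Q, ∃ (x : Fin 3 → 𝓞 F) (P : PtRep F m f),
      (∀ i, P.y i = algebraMap (𝓞 F) F (z i)) ∧ (∀ j, P.x j = algebraMap (𝓞 F) F (x j)) ∧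
        H P ≤ B ∧ Quot.mk (ptRel a f) P = q.1 := by
    rintro ⟨q, P, hPy, hPB, rfl⟩
    obtain ⟨x, P', hy', hx', hrel⟩ := exists_integral_rep a P
    exact ⟨x, P', fun i => by rw [hy', hPy], hx', hHinv _ _ hrel ▸ hPB, (Quot.sound hrel).symm⟩
  choose x P hPy hPx hPB hPq using hrep
  set M : Matrix (Fin 3) (Fin 3) (𝓞 F) := Matrix.of fun i j => eval z (f i j) with hMdef
  have hM : ∀ i j, M i j = M j i := fun i j => by simp [hMdef, hf i j]
  have hnull : ∀ q, bil M (x q) (x q) = 0 := fun q => bil_self_eq_zero (P q) (hPy q) (hPx q)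
  have hx0 : ∀ q, x q ≠ 0 := fun q h => (P q).hx (funext fun j => by simp [hPx, h])
  have hsep : ∀ q q', bil M (x q) (x q') = 0 → q = q' := by
    intro q q' h
    have hprop := proportional_of_bil_eq_zero hM hΔ (hnull q) (hnull q') h
    have hrel : ptRel a f (P q) (P q') := by
      refine ptRel_of_proportional a (funext fun i => by rw [hPy, hPy]) fun i j => ?_
      rw [hPx, hPx, hPx, hPx, ← map_mul, ← map_mul, hprop i j]
    exact Subtype.ext ((hPq q).symm.trans ((Quot.sound hrel).trans (hPq q')))
  have hinj : Function.Injective x := fun q q' h => hsep q q' (h ▸ hnull q)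
  have := Fintype.ofFinite Q
  have hcard : Nat.card Q = (Finset.univ.image x).card := by
    rw [Finset.card_image_of_injective _ hinj, Nat.card_eq_fintype_card, Finset.card_univ]
  rw [hcard]
  have hHz := Real.rpow_pos_of_pos (Hinf_pos hz) (Aexp m a e α)
  refine card_isotropic_le hM hΔ _ (by simpa using hx0) (by simpa using hnull) ?_ a hz ?_ w₀ hL hbig
  · intro u hu v hv huv h
    obtain ⟨q, -, rfl⟩ := Finset.mem_image.1 hu
    obtain ⟨q', -, rfl⟩ := Finset.mem_image.1 hv
    exact huv (congrArg x (hsep q q' h))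
  · intro u hu
    obtain ⟨q, -, rfl⟩ := Finset.mem_image.1 hu
    have h1 := le_Hstd a e α f (P q) hz (hPy q) (hPx q) hE
    have h2 := (mul_le_mul_of_nonneg_left h1 hc.le).trans ((hH (P q)).trans (hPB q))
    have pos : ∀ {I : Ideal (𝓞 F)}, I ≠ ⊥ → 0 < (Ideal.absNorm I : ℝ) := fun {I} hI => by
      rw [Nat.cast_pos, Nat.pos_iff_ne_zero, Ne, Ideal.absNorm_eq_zero_iff]; exact hI
    have p1 := pos (contentIdeal_ne_bot hz)
    have p2 := pos (contentIdeal_ne_bot (hx0 q))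
    rw [div_mul_eq_mul_div, le_div_iff₀ (by positivity)]
    rw [← div_eq_mul_inv, mul_div_assoc', div_le_iff₀ (by positivity)] at h2
    linarith

lemma exists_nat_pow_between {t : ℝ} (ht : 0 ≤ t) {d : ℕ} (hd : d = 1 ∨ d = 2) :
    ∃ L : ℕ, 1 ≤ L ∧ t < (L : ℝ) ^ d ∧ (L : ℝ) ^ d ≤ 4 * (t + 1) := by
  rcases hd with rfl | rfl
  · refine ⟨⌊t⌋₊ + 1, by omega, ?_, ?_⟩
    · push_cast; rw [pow_one]; exact Nat.lt_floor_add_one t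
    · push_cast; rw [pow_one]; linarith [Nat.floor_le ht]
  · have hs := Real.sq_sqrt ht
    have h0 := Real.sqrt_nonneg t
    have h1 := Nat.lt_floor_add_one (Real.sqrt t)
    have h2 := Nat.floor_le h0
    refine ⟨⌊Real.sqrt t⌋₊ + 1, by omega, ?_, ?_⟩
    · push_cast; nlinarith
    · push_cast; nlinarith [sq_nonneg (Real.sqrt t - 1)]

/-- The main term, raised to a power that clears its fractional exponents. -/
lemma mainTerm_pow {B N h δ s A : ℝ} (hB : 0 < B) (hN : 0 ≤ N) (hh : 0 < h) (hδ : 0 < δ) :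
    (B * N ^ ((1 : ℝ) / 2) / (h ^ (s / 3 + A) * δ ^ ((1 : ℝ) / 3))) ^ 6 * (δ * h ^ s) ^ 2 =
      (B / h ^ A) ^ 6 * N ^ 3 := by
  have h1 : (N ^ ((1 : ℝ) / 2)) ^ 6 = N ^ 3 := by
    rw [← Real.rpow_natCast, ← Real.rpow_mul hN, ← Real.rpow_natCast]; norm_num
  have h2 : (δ ^ ((1 : ℝ) / 3)) ^ 6 = δ ^ 2 := by
    rw [← Real.rpow_natCast, ← Real.rpow_mul hδ.le, ← Real.rpow_natCast]; norm_num
  have h3 : (h ^ (s / 3 + A)) ^ 6 = (h ^ s) ^ 2 * (h ^ A) ^ 6 := by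
    rw [← Real.rpow_natCast, ← Real.rpow_natCast, ← Real.rpow_natCast, ← Real.rpow_mul hh.le,
      ← Real.rpow_mul hh.le, ← Real.rpow_mul hh.le, ← Real.rpow_add hh]
    congr 1; push_cast; ring
  have p1 := Real.rpow_pos_of_pos hh s
  have p2 := Real.rpow_pos_of_pos hh A
  rw [div_pow, mul_pow, mul_pow, h1, h2, h3]
  field_simp

end Fibres

/-- Lemma 3.5 / `lem:conics_bound`: the uniform upper bound for
the number of points of bounded height on the conic fibres. -/
theorem statement_8
    (k : Type) [Field k] [NumberField k]
    (n : ℕ) (hn : 1 ≤ n)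
    (a : Fin 3 → ℤ) (ha : a 0 ≤ a 1 ∧ a 1 ≤ a 2) (e : ℤ)
    (f : Fin 3 → Fin 3 → MvPolynomial (Fin (n + 1)) (𝓞 k))
    (hf : DegOK a e f) (hsmooth : IsSmoothX f)
    -- a fixed finite set of integral ideals representing the ideal classes of `k`:
    (𝒞 : Finset (Ideal (𝓞 k))) (h𝒞 : ∀ I ∈ 𝒞, I ≠ ⊥)
    (α : ℚ)
    (H : PtRep k n f → ℝ)
    (hHpos : ∀ P, 0 < H P)
    (hHinv : ∀ P P', ptRel a f P P' → H P = H P')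
    (hH : ∃ c₁ c₂ : ℝ, 0 < c₁ ∧ c₁ ≤ c₂ ∧ ∀ P,
      c₁ * Hstd a e α f P ≤ H P ∧ H P ≤ c₂ * Hstd a e α f P) :
    ∃ C : ℝ, 0 < C ∧
      ∀ (z : Fin (n + 1) → 𝓞 k), DeltaO f z ≠ 0 →
        Ideal.span (Set.range z) ∈ 𝒞 →
        ∀ B : ℝ, 0 < B →
          (NcountFib a f z H B : ℝ) ≤
            C * (tauk (DeltaO f z) : ℝ) *
              (B * (Ideal.absNorm (minorsIdeal f z) : ℝ) ^ ((1 : ℝ) / 2) /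
                  (Hinf z ^ ((((a 0 : ℤ) : ℝ) + ((a 1 : ℤ) : ℝ) + ((a 2 : ℤ) : ℝ)) / 3
                      + Aexp n a e α) *
                    ((Algebra.norm ℤ (DeltaO f z)).natAbs : ℝ) ^ ((1 : ℝ) / 3)) + 1) := by
  obtain ⟨c, _, hc, -, hH⟩ := hH
  obtain ⟨E, hE⟩ : ∃ E : ℕ, ∀ j, Aexp n a e α + a j ≤ E := by
    obtain ⟨E, hE⟩ := exists_nat_ge (Finset.univ.sup' Finset.univ_nonempty
      fun j => Aexp n a e α + a j)
    exact ⟨E, fun j => (Finset.le_sup' (fun j => Aexp n a e α + a j) (Finset.mem_univ j)).trans hE⟩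
  obtain ⟨K, hK0, hK⟩ : ∃ K : ℝ, 0 ≤ K ∧ ∀ I ∈ 𝒞, (Ideal.absNorm I : ℝ) ^ E ≤ K :=
    ⟨∑ I ∈ 𝒞, (Ideal.absNorm I : ℝ) ^ E, Finset.sum_nonneg fun I _ => by positivity,
      fun I hI => Finset.single_le_sum (f := fun I : Ideal (𝓞 k) => (Ideal.absNorm I : ℝ) ^ E)
        (fun I _ => by positivity) hI⟩
  obtain ⟨κ, hκdef⟩ : ∃ κ : ℝ, κ = (Ideal.absNorm (Ideal.span {(4 : 𝓞 k)}) : ℝ) := ⟨_, rfl⟩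
  have hκ : 0 ≤ κ := by rw [hκdef]; exact Nat.cast_nonneg _
  obtain ⟨G, hGdef⟩ : ∃ G : ℝ, G = ∏ w : InfinitePlace k, (384 : ℝ) ^ w.mult := ⟨_, rfl⟩
  have hG : 0 ≤ G := by
    rw [hGdef]
    exact Finset.prod_nonneg fun w _ => pow_nonneg (by norm_num) _
  obtain ⟨C₁, hC₁def⟩ : ∃ C₁ : ℝ, C₁ = (κ + 1) * (G + 1) * (K / c) := ⟨_, rfl⟩
  have hC₁ : 0 ≤ C₁ := by
    rw [hC₁def]
    exact mul_nonneg (mul_nonneg (by linarith) (by linarith)) (div_nonneg hK0 hc.le)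
  obtain ⟨w₀⟩ : Nonempty (InfinitePlace k) := inferInstance
  have hmult : w₀.mult = 1 ∨ w₀.mult = 2 := by
    rw [InfinitePlace.mult]; split_ifs <;> simp
  refine ⟨144 * (C₁ + 1), by positivity, fun z hΔ hz𝒞 B hB => ?_⟩
  have hz : z ≠ 0 := by
    rintro rfl
    refine h𝒞 _ hz𝒞 (Ideal.span_eq_bot.2 ?_)
    rintro _ ⟨i, rfl⟩
    rfl
  rw [← Ideal.absNorm_span_singleton]
  have hδ : (0 : ℝ) < Ideal.absNorm (Ideal.span {DeltaO f z}) := by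
    exact_mod_cast absNorm_span_pos hΔ
  have hHz := Hinf_pos hz
  have hmain := mainTerm_pow (s := (a 0 : ℝ) + a 1 + a 2) (A := Aexp n a e α) hB
    (Nat.cast_nonneg (Ideal.absNorm (minorsIdeal f z))) hHz hδ
  set Z := B * (Ideal.absNorm (minorsIdeal f z) : ℝ) ^ ((1 : ℝ) / 2) /
    (Hinf z ^ (((a 0 : ℝ) + a 1 + a 2) / 3 + Aexp n a e α) *
      (Ideal.absNorm (Ideal.span {DeltaO f z}) : ℝ) ^ ((1 : ℝ) / 3)) with hZdef
  have hZ : 0 ≤ Z := by positivity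
  obtain ⟨L, hL, hlt, hle⟩ := exists_nat_pow_between (mul_nonneg hC₁ hZ) hmult
  have hKz : (Ideal.absNorm (contentIdeal z) : ℝ) ^ E ≤ K := hK _ hz𝒞
  have hcount := ncountFib_le a (fun i j => (hf i j).1) hHinv hc (fun P => (hH P).1) hz hΔ hE B w₀
    hL (by
      rw [← hκdef, ← hGdef]
      have p1 := Real.rpow_pos_of_pos hHz (Aexp n a e α)
      have p2 := Real.rpow_pos_of_pos hHz ((a 0 : ℝ) + a 1 + a 2)
      calc _ ≤ κ * (Ideal.absNorm (minorsIdeal f z) : ℝ) ^ 3 *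
            (G * (B * K / (c * Hinf z ^ Aexp n a e α)) ^ 3) ^ 2 := by gcongr
        _ = κ * G ^ 2 * (K / c) ^ 6 * ((B / Hinf z ^ Aexp n a e α) ^ 6 *
            (Ideal.absNorm (minorsIdeal f z) : ℝ) ^ 3) := by field_simp
        _ ≤ (κ + 1) ^ 6 * (G + 1) ^ 6 * (K / c) ^ 6 * ((B / Hinf z ^ Aexp n a e α) ^ 6 *
            (Ideal.absNorm (minorsIdeal f z) : ℝ) ^ 3) := by
          have h1 : κ ≤ (κ + 1) ^ 6 :=
            (by linarith : κ ≤ κ + 1).trans (le_self_pow₀ (by linarith) (by norm_num))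
          have h2 : G ^ 2 ≤ (G + 1) ^ 6 :=
            (pow_le_pow_left₀ hG (by linarith) 2).trans
              (pow_le_pow_right₀ (by linarith) (by norm_num))
          gcongr
        _ = (C₁ * Z) ^ 6 * (Ideal.absNorm (Ideal.span {DeltaO f z}) *
            Hinf z ^ ((a 0 : ℝ) + a 1 + a 2)) ^ 2 := by
          rw [← hmain, hC₁def]; ring
        _ < ((L : ℝ) ^ w₀.mult) ^ 6 * (Ideal.absNorm (Ideal.span {DeltaO f z}) *
            Hinf z ^ ((a 0 : ℝ) + a 1 + a 2)) ^ 2 := by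
          have := pow_lt_pow_left₀ hlt (by positivity) (n := 6) (by norm_num)
          gcongr
        _ = _ := by ring)
  calc (NcountFib a f z H B : ℝ)
      ≤ 36 * tauk (DeltaO f z) * (L : ℝ) ^ w₀.mult := by exact_mod_cast hcount
    _ ≤ 36 * tauk (DeltaO f z) * (4 * (C₁ * Z + 1)) := by gcongr
    _ = 144 * tauk (DeltaO f z) * (C₁ * Z + 1) := by ring
    _ ≤ 144 * tauk (DeltaO f z) * ((C₁ + 1) * (Z + 1)) := by
      gcongr
      nlinarith
    _ = _ := by ring

end Stmt
end
end

section
/- Let α be a rational number with α > e + 2(a₀+a₁+a₂)/3, let H be a height associated to −K_X + αF, set A = n+1+α−(a₀+a₁+a₂+e), and let U be a nonempty Zariski-open subset of X such that x₂ ≠ 0 at every point of U. Then there exists a constant C > 0 such that for every B > 0 and every point (y;x) ∈ U(k) with H(y;x) ≤ B, one has H(y) ≤ C·B^{1/(A+a₂)}. -/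
/-!
Setup (Frei–Loughran, "Rational points and non-anticanonical height functions",
§2–§3): `k` a number field, `X ⊂ F_n(a₀,a₁,a₂)` a smooth hypersurface of
bidegree `(e,2)` cut out by `Q(y,x) = ∑ f_{i,j}(y) xᵢ xⱼ`, with projection
`π : X → ℙⁿ`, discriminant `Δ(y) = det (f_{i,j}(y))`, and standard height `H*`
associated to the `ℚ`-divisor `-K_X + αF`.
-/

noncomputable section

open MvPolynomial NumberField Filter Topology IsDedekindDomain

namespace Stmt

variable (k : Type) [Field k] [NumberField k] (n : ℕ)

variable {k n}

/-- The standard (absolute, multiplicative) projective height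
`H(y) = ∏_v max_i |y_i|_v^{m_v}` of a point `y ∈ ℙⁿ(k)` given by a representative
`(y₀, …, y_n) ∈ kⁿ⁺¹ ∖ {0}` (well-defined by the product formula). -/
def Hproj {ι : Type} [Fintype ι] [Nonempty ι] (z : ι → k) : ℝ :=
  (∏ w : InfinitePlace k, maxAt w z ^ w.mult) * ∏ᶠ v : HeightOneSpectrum (𝓞 k), maxAtFin v z

theorem fnorm_eq_finitePlace (v : HeightOneSpectrum (𝓞 k)) (z : k) :
    fnorm v z = FinitePlace.mk v z := by
  rw [FinitePlace.mk_apply, FinitePlace.norm_embedding']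
  unfold fnorm
  split_ifs with h
  · rw [WithZeroMulInt.toNNReal_pos_apply _ h]; simp
  · rw [WithZeroMulInt.toNNReal_neg_apply _ h]; simp

theorem fnorm_nonneg (v : HeightOneSpectrum (𝓞 k)) (z : k) : 0 ≤ fnorm v z := by
  rw [fnorm_eq_finitePlace]
  exact apply_nonneg _ _

theorem fnorm_pos (v : HeightOneSpectrum (𝓞 k)) {z : k} (hz : z ≠ 0) : 0 < fnorm v z := by
  refine (fnorm_nonneg v z).lt_of_ne' ?_
  rw [fnorm_eq_finitePlace]
  simpa using hz

theorem finite_fnorm_ne_one {z : k} (hz : z ≠ 0) :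
    {v : HeightOneSpectrum (𝓞 k) | fnorm v z ≠ 1}.Finite := by
  simp only [fnorm_eq_finitePlace]
  exact (FinitePlace.hasFiniteMulSupport hz).preimage
    (FinitePlace.equivHeightOneSpectrum (K := k)).symm.injective.injOn

/-- The product formula, with the finite places indexed by height-one primes. -/
theorem prod_abs_mul_finprod_fnorm {z : k} (hz : z ≠ 0) :
    (∏ w : InfinitePlace k, w z ^ w.mult) * ∏ᶠ v : HeightOneSpectrum (𝓞 k), fnorm v z = 1 := by
  rw [← prod_abs_eq_one hz, ← finprod_comp_equiv FinitePlace.equivHeightOneSpectrum.symm]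
  simp only [fnorm_eq_finitePlace, FinitePlace.equivHeightOneSpectrum_symm_apply,
    FinitePlace.mk_apply]

section Max

variable {ι : Type} [Fintype ι] [Nonempty ι]

theorem maxAt_pos_s9 {K : Type} [Field K] (w : InfinitePlace K) {z : ι → K} (hz : z ≠ 0) :
    0 < maxAt w z := by
  obtain ⟨i, hi⟩ := Function.ne_iff.mp hz
  exact (Finset.lt_sup'_iff _).mpr ⟨i, Finset.mem_univ i, w.pos_iff.mpr hi⟩

theorem maxAtFin_pos (v : HeightOneSpectrum (𝓞 k)) {z : ι → k} (hz : z ≠ 0) :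
    0 < maxAtFin v z := by
  obtain ⟨i, hi⟩ := Function.ne_iff.mp hz
  exact (Finset.lt_sup'_iff _).mpr ⟨i, Finset.mem_univ i, fnorm_pos v hi⟩

theorem finite_maxAtFin_ne_one {z : ι → k} (hz : z ≠ 0) :
    {v : HeightOneSpectrum (𝓞 k) | maxAtFin v z ≠ 1}.Finite := by
  have hfin : (⋃ i : {i // z i ≠ 0},
      {v : HeightOneSpectrum (𝓞 k) | fnorm v (z i) ≠ 1}).Finite :=
    Set.finite_iUnion fun i => finite_fnorm_ne_one i.2
  refine hfin.subset fun v hv => ?_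
  by_contra hcon
  simp only [Set.mem_iUnion, Set.mem_ofPred_eq, not_exists, not_not, Subtype.forall] at hcon
  obtain ⟨i, hi⟩ := Function.ne_iff.mp hz
  refine hv (le_antisymm (Finset.sup'_le _ _ fun j _ => ?_) ?_)
  · by_cases hj : z j = 0
    · simp [hj, fnorm_eq_finitePlace]
    · exact (hcon j hj).le
  · exact (hcon i hi).symm.le.trans
      (Finset.le_sup' (fun j => fnorm v (z j)) (Finset.mem_univ i))

theorem Hproj_pos {z : ι → k} (hz : z ≠ 0) : 0 < Hproj z :=
  mul_pos (Finset.prod_pos fun w _ => pow_pos (maxAt_pos_s9 w hz) _)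
    (finprod_induction (0 < ·) one_pos (fun _ _ => mul_pos) fun v => maxAtFin_pos v hz)

end Max

theorem rpow_add_mul_le_sup {ι : Type} [Fintype ι] [Nonempty ι] {M : ℝ} (hM : 0 < M)
    (A : ℝ) (b t : ι → ℝ) (j : ι) :
    M ^ (A + b j) * t j ≤
      M ^ A * Finset.univ.sup' Finset.univ_nonempty (fun i => M ^ b i * t i) := by
  rw [Real.rpow_add hM, mul_assoc]
  exact mul_le_mul_of_nonneg_left
    (Finset.le_sup' (fun i => M ^ b i * t i) (Finset.mem_univ j)) (Real.rpow_nonneg hM.le _)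

/-- Each nonzero coordinate `x_j` bounds the standard height from below by `H(y)^(A + a_j)`. -/
theorem Hproj_rpow_le_Hstd (a : Fin 3 → ℤ) (e : ℤ) (α : ℚ)
    (f : Fin 3 → Fin 3 → MvPolynomial (Fin (n + 1)) (𝓞 k)) (P : PtRep k n f)
    {j : Fin 3} (hj : P.x j ≠ 0) :
    Hproj P.y ^ (Aexp n a e α + ((a j : ℤ) : ℝ)) ≤ Hstd a e α f P := by
  set s := Aexp n a e α + ((a j : ℤ) : ℝ)
  have hMpos := fun w : InfinitePlace k => maxAt_pos_s9 w P.hy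
  have hNpos := fun v : HeightOneSpectrum (𝓞 k) => maxAtFin_pos v P.hy
  obtain ⟨S, hS⟩ := (((finite_maxAtFin_ne_one P.hy).union (finite_maxAtFin_ne_one P.hx)).union
    (finite_fnorm_ne_one hj)).exists_finset_coe
  have hout : ∀ v ∉ S, maxAtFin v P.y = 1 ∧ maxAtFin v P.x = 1 ∧ fnorm v (P.x j) = 1 := by
    intro v hv
    rw [← Finset.mem_coe, hS] at hv
    simp only [Set.mem_union, Set.mem_ofPred_eq, not_or, not_not] at hv
    exact ⟨hv.1.1, hv.1.2, hv.2⟩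
  have hsub {F : HeightOneSpectrum (𝓞 k) → ℝ} (hF : ∀ v ∉ S, F v = 1) :
      ∏ᶠ v, F v = ∏ v ∈ S, F v :=
    finprod_eq_prod_of_mulSupport_subset F fun v hv => by
      by_contra h
      exact hv (hF v h)
  have hprod := prod_abs_mul_finprod_fnorm hj
  rw [hsub fun v hv => (hout v hv).2.2] at hprod
  have hwnn (w : InfinitePlace k) : 0 ≤ maxAt w P.y ^ s * w (P.x j) :=
    mul_nonneg (Real.rpow_nonneg (hMpos w).le _) (apply_nonneg _ _)
  have hvnn (v : HeightOneSpectrum (𝓞 k)) : 0 ≤ maxAtFin v P.y ^ s * fnorm v (P.x j) :=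
    mul_nonneg (Real.rpow_nonneg (hNpos v).le _) (fnorm_nonneg _ _)
  have hwle := fun w : InfinitePlace k => rpow_add_mul_le_sup (hMpos w) (Aexp n a e α)
    (fun i => ((a i : ℤ) : ℝ)) (fun i => w (P.x i)) j
  have hvle := fun v : HeightOneSpectrum (𝓞 k) => rpow_add_mul_le_sup (hNpos v) (Aexp n a e α)
    (fun i => ((a i : ℤ) : ℝ)) (fun i => fnorm v (P.x i)) j
  unfold Hproj Hstd
  rw [hsub fun v hv => (hout v hv).1, hsub fun v hv => by
    rw [(hout v hv).1]
    simpa [maxAtFin] using (hout v hv).2.1]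
  calc _ = (∏ w : InfinitePlace k, (maxAt w P.y ^ s * w (P.x j)) ^ w.mult) *
        ∏ v ∈ S, (maxAtFin v P.y ^ s * fnorm v (P.x j)) := by
        rw [Real.mul_rpow (Finset.prod_nonneg fun w _ => pow_nonneg (hMpos w).le _)
          (Finset.prod_nonneg fun v _ => (hNpos v).le),
          ← Real.finsetProd_rpow _ _ fun w _ => pow_nonneg (hMpos w).le _,
          ← Real.finsetProd_rpow _ _ fun v _ => (hNpos v).le]
        simp only [mul_pow, Finset.prod_mul_distrib]
        rw [mul_mul_mul_comm, hprod, mul_one]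
        congr 1
        refine Finset.prod_congr rfl fun w _ => ?_
        rw [← Real.rpow_natCast_mul (hMpos w).le, mul_comm, Real.rpow_mul_natCast (hMpos w).le]
    _ ≤ _ :=
        mul_le_mul
          (Finset.prod_le_prod (fun w _ => pow_nonneg (hwnn w) _)
            fun w _ => pow_le_pow_left₀ (hwnn w) (hwle w) _)
          (Finset.prod_le_prod (fun v _ => hvnn v) fun v _ => hvle v)
          (Finset.prod_nonneg fun v _ => hvnn v)
          (Finset.prod_nonneg fun w _ => pow_nonneg ((hwnn w).trans (hwle w)) _)

theorem Aexp_add_pos (n : ℕ) {a : Fin 3 → ℤ} (ha : a 0 ≤ a 1 ∧ a 1 ≤ a 2) {e : ℤ} {α : ℚ}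
    (hα : (e : ℚ) + 2 * (((a 0 : ℚ) + (a 1 : ℚ) + (a 2 : ℚ)) / 3) < α) :
    0 < Aexp n a e α + ((a 2 : ℤ) : ℝ) := by
  have h01 : ((a 0 : ℤ) : ℝ) ≤ a 1 := mod_cast ha.1
  have h12 : ((a 1 : ℤ) : ℝ) ≤ a 2 := mod_cast ha.2
  have hα' : (e : ℝ) + 2 * (((a 0 : ℝ) + (a 1 : ℝ) + (a 2 : ℝ)) / 3) < α := mod_cast hα
  have hn : (0 : ℝ) ≤ n := n.cast_nonneg
  unfold Aexp
  linarith

/-- Lemma 3.6 / `lem:y_small`: points of bounded height in `U`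
lie over points of `ℙⁿ(k)` of height `O(B^{1/(A+a₂)})`. -/
theorem statement_9
    (k : Type) [Field k] [NumberField k]
    (n : ℕ) (hn : 1 ≤ n)
    (a : Fin 3 → ℤ) (ha : a 0 ≤ a 1 ∧ a 1 ≤ a 2) (e : ℤ)
    (f : Fin 3 → Fin 3 → MvPolynomial (Fin (n + 1)) (𝓞 k))
    (hf : DegOK a e f) (hsmooth : IsSmoothX f)
    (α : ℚ) (hα : (e : ℚ) + 2 * (((a 0 : ℚ) + (a 1 : ℚ) + (a 2 : ℚ)) / 3) < α)
    (H : PtRep k n f → ℝ)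
    (hHpos : ∀ P, 0 < H P)
    (hHinv : ∀ P P', ptRel a f P P' → H P = H P')
    (hH : ∃ c₁ c₂ : ℝ, 0 < c₁ ∧ c₁ ≤ c₂ ∧ ∀ P,
      c₁ * Hstd a e α f P ≤ H P ∧ H P ≤ c₂ * Hstd a e α f P)
    (U : Set (PtRep k n f))
    (ι : Type) (g : ι → MvPolynomial (Fin (n + 1) ⊕ Fin 3) k)
    (hg : ∀ i, IsBihom a (g i))
    (hUopen : U = {P | ∃ i, eval (Sum.elim P.y P.x) (g i) ≠ 0})
    (hUne : U.Nonempty)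
    (hUx : ∀ P ∈ U, P.x 2 ≠ 0) :
    ∃ C : ℝ, 0 < C ∧ ∀ B : ℝ, 0 < B → ∀ P ∈ U, H P ≤ B →
      Hproj P.y ≤ C * B ^ (1 / (Aexp n a e α + ((a 2 : ℤ) : ℝ))) := by
  have hs := Aexp_add_pos n ha hα
  obtain ⟨c₁, c₂, hc₁, -, hc⟩ := hH
  set s := Aexp n a e α + ((a 2 : ℤ) : ℝ)
  refine ⟨c₁⁻¹ ^ (1 / s), by positivity, fun B hB P hP hPB => ?_⟩
  have hle : Hproj P.y ^ s ≤ c₁⁻¹ * B := by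
    rw [le_inv_mul_iff₀ hc₁]
    exact (mul_le_mul_of_nonneg_left (Hproj_rpow_le_Hstd a e α f P (hUx P hP)) hc₁.le).trans
      ((hc P).1.trans hPB)
  rw [← Real.mul_rpow (by positivity) hB.le, one_div]
  exact (Real.le_rpow_inv_iff_of_pos (Hproj_pos P.hy).le (by positivity) hs).mpr hle

end Stmt
end
end
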